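/- (Generalized escape through a mesh, lower bound) Let G ∈ R^{n×d} have i.i.d. N(0, 1/n) entries scaled so that the rows of √n·G are standard Gaussian, let B ∈ R^{d×d} with smallest singular value σ_b > 0, and let C ⊆ R^d be a cone. Then with probability at least 1 − e^{−θ²/2}, for all v ∈ C with Bv/‖Bv‖₂ ∈ B(C) ∩ S^{d−1}: ‖√n·GBv‖₂ ≥ [p_n − W(BC ∩ S^{d−1}) − θ] · ‖Bv‖₂ ≥ σ_b [p_n − W(BC ∩ S^{d−1}) − θ] ‖v‖₂, where p_n = E‖g‖₂ for g ∼ N(0, I_n) and W(T) := E_{h∼N(0,I_d)} sup_{t ∈ T} ⟨t, h⟩ is the Gaussian width. -/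

import Mathlib

open scoped BigOperators
open MeasureTheory ProbabilityTheory Matrix

/-- Euclidean norm on `Fin d → ℝ`. -/
noncomputable def euclNorm {d : ℕ} (v : Fin d → ℝ) : ℝ := Real.sqrt (∑ j, v j ^ 2)

/-- Euclidean inner product on `Fin d → ℝ`. -/
noncomputable def dot {d : ℕ} (u v : Fin d → ℝ) : ℝ := ∑ j, u j * v j

/-- Standard Gaussian measure on `Fin n → ℝ`. -/
noncomputable def stdGaussian (n : ℕ) : Measure (Fin n → ℝ) :=
  Measure.pi fun _ => gaussianReal 0 1

/-- Standard Gaussian matrix measure on `Fin n → Fin d → ℝ` (i.i.d. `N(0,1)` entries). -/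
noncomputable def stdGaussianMatrix (n d : ℕ) : Measure (Fin n → Fin d → ℝ) :=
  Measure.pi fun _ => stdGaussian d

/-- i.i.d. standard Gaussians indexed by a finite type -/
noncomputable def gpi (ι : Type) [Fintype ι] : Measure (ι → ℝ) :=
  Measure.pi fun _ => gaussianReal 0 1

instance gpi_prob (ι : Type) [Fintype ι] : IsProbabilityMeasure (gpi ι) := by
  unfold gpi; infer_instance

lemma gpi_comp_inj {ι κ : Type} [Fintype ι] [Fintype κ] (f : κ → ι) (hf : Function.Injective f) :
    MeasurePreserving (fun (x : ι → ℝ) j => x (f j)) (gpi ι) (gpi κ) := by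
  refine ⟨by fun_prop, ?_⟩
  have := Measure.map_infinitePi_infinitePi_of_inj (P := fun _ : ι => gaussianReal 0 1) hf
  rw [Measure.infinitePi_eq_pi, Measure.infinitePi_eq_pi] at this
  exact this

lemma gpi_curry (ι κ : Type) [Fintype ι] [Fintype κ] :
    MeasurePreserving (fun (x : ι × κ → ℝ) i j => x (i, j)) (gpi (ι × κ))
      (Measure.pi fun _ : ι => gpi κ) := by
  refine ⟨by fun_prop, ?_⟩
  have := Measure.infinitePi_map_curry (fun (_ : ι) (_ : κ) => gaussianReal 0 1)
  simp only [Measure.infinitePi_eq_pi] at this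
  exact this

lemma gpi_update {ι : Type} [Fintype ι] [DecidableEq ι] (i : ι) :
    MeasurePreserving (fun p : (ι → ℝ) × ℝ => Function.update p.1 i p.2)
      ((gpi ι).prod (gaussianReal 0 1)) (gpi ι) := by
  have hm : Measurable (fun p : (ι → ℝ) × ℝ => Function.update p.1 i p.2) := by
    rw [measurable_pi_iff]
    intro j
    by_cases h : j = i
    · subst h; simp only [Function.update_self]; exact measurable_snd
    · simp only [Function.update_of_ne h]; fun_prop
  refine ⟨hm, ?_⟩
  symm
  apply Measure.pi_eq
  intro s hs
  rw [Measure.map_apply hm (MeasurableSet.univ_pi hs)]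
  have : (fun p : (ι → ℝ) × ℝ => Function.update p.1 i p.2) ⁻¹' Set.univ.pi s
      = (Set.univ.pi (Function.update s i Set.univ)) ×ˢ (s i) := by
    ext ⟨x, t⟩
    simp only [Set.mem_preimage, Set.mem_pi, Set.mem_univ, true_imp_iff, Set.mem_prod]
    constructor
    · intro h
      refine ⟨fun j => ?_, by simpa using h i⟩
      by_cases hj : j = i
      · subst hj; simp
      · simpa [hj] using h j
    · rintro ⟨h1, h2⟩ j
      by_cases hj : j = i
      · subst hj; simpa using h2
      · simpa [hj] using h1 j
  rw [this, Measure.prod_prod, gpi, Measure.pi_pi, ← Finset.mul_prod_erase _ _ (Finset.mem_univ i),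
    ← Finset.mul_prod_erase Finset.univ (fun j => (gaussianReal 0 1) (s j)) (Finset.mem_univ i)]
  simp only [Function.update_self, measure_univ, one_mul]
  rw [mul_comm]
  congr 1
  apply Finset.prod_congr rfl
  intro j hj
  rw [Function.update_of_ne (Finset.ne_of_mem_erase hj)]

lemma integrable_exp_abs_gauss (c : ℝ) :
    Integrable (fun x : ℝ => Real.exp (c * |x|)) (gaussianReal 0 1) :=
  integrable_exp_mul_abs (X := fun x : ℝ => x) (integrable_exp_mul_gaussianReal c)
    (integrable_exp_mul_gaussianReal (-c))

lemma gpi_exp {ι : Type} [Fintype ι] (c : ℝ) :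
    Integrable (fun x : ι → ℝ => Real.exp (c * ∑ i, |x i|)) (gpi ι) := by
  have := Integrable.fintype_prod (μ := fun _ : ι => gaussianReal 0 1)
    (f := fun _ x => Real.exp (c * |x|)) (fun i => integrable_exp_abs_gauss c)
  simpa [Finset.mul_sum, Real.exp_sum, gpi] using this

lemma gpi_dom {ι : Type} [Fintype ι] (A c : ℝ) (f : (ι → ℝ) → ℝ)
    (hm : AEStronglyMeasurable f (gpi ι)) (h : ∀ x, |f x| ≤ A * Real.exp (c * ∑ i, |x i|)) :
    Integrable f (gpi ι) :=
  ((gpi_exp c).const_mul A).mono' hm (Filter.Eventually.of_forall h)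

lemma gauss_pdf_deriv (x : ℝ) :
    HasDerivAt (gaussianPDFReal 0 1) (-(x * gaussianPDFReal 0 1 x)) x := by
  have h1 : HasDerivAt (fun x : ℝ => -(x - 0) ^ 2 / (2 * ((1 : NNReal) : ℝ))) (-x) x := by
    have := ((((hasDerivAt_id x).sub_const 0).pow 2).neg).div_const (2 * ((1 : NNReal) : ℝ))
    refine this.congr_deriv ?_
    simp
    ring
  have := (h1.exp).const_mul ((Real.sqrt (2 * Real.pi * ((1 : NNReal) : ℝ)))⁻¹)
  unfold gaussianPDFReal
  refine this.congr_deriv ?_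
  ring

lemma integrable_gauss_iff (f : ℝ → ℝ) :
    Integrable f (gaussianReal 0 1) ↔ Integrable (fun x => f x * gaussianPDFReal 0 1 x) := by
  rw [gaussianReal_of_var_ne_zero 0 one_ne_zero, gaussianPDF_def]
  rw [integrable_withDensity_iff (by fun_prop) (by simp)]
  simp [ENNReal.toReal_ofReal, gaussianPDFReal_nonneg]

lemma gauss_ibp (f f' : ℝ → ℝ) (hd : ∀ x, HasDerivAt f (f' x) x)
    (hf : Integrable f (gaussianReal 0 1)) (hxf : Integrable (fun x => x * f x) (gaussianReal 0 1))
    (hf' : Integrable f' (gaussianReal 0 1)) :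
    ∫ x, x * f x ∂(gaussianReal 0 1) = ∫ x, f' x ∂(gaussianReal 0 1) := by
  rw [integral_gaussianReal_eq_integral_smul one_ne_zero,
    integral_gaussianReal_eq_integral_smul one_ne_zero]
  rw [integrable_gauss_iff] at hf hxf hf'
  have := integral_mul_deriv_eq_deriv_mul_of_integrable (u := f) (u' := f')
    (v := gaussianPDFReal 0 1) (v' := fun x => -(x * gaussianPDFReal 0 1 x))
    (fun x _ => hd x) (fun x _ => gauss_pdf_deriv x) ?_ hf' hf
  · simp only [smul_eq_mul]
    rw [← neg_inj, ← integral_neg]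
    calc _ = ∫ x, f x * -(x * gaussianPDFReal 0 1 x) := by congr 1; ext x; ring
      _ = _ := this
      _ = _ := by congr 2; ext x; ring
  · refine hxf.neg.congr (Filter.Eventually.of_forall fun x => ?_)
    simp only [Pi.neg_apply, Pi.mul_apply]; ring

lemma gpi_ibp {ι : Type} [Fintype ι] [DecidableEq ι] (i : ι) (f f' : (ι → ℝ) → ℝ)
    (hd : ∀ x, HasDerivAt (fun t => f (Function.update x i t)) (f' x) (x i))
    (hf : Integrable f (gpi ι)) (hxf : Integrable (fun x => x i * f x) (gpi ι))
    (hf' : Integrable f' (gpi ι)) :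
    ∫ x, x i * f x ∂(gpi ι) = ∫ x, f' x ∂(gpi ι) := by
  have hU := gpi_update i
  have key : ∀ g : (ι → ℝ) → ℝ, Integrable g (gpi ι) →
      Integrable (fun p : (ι → ℝ) × ℝ => g (Function.update p.1 i p.2))
        ((gpi ι).prod (gaussianReal 0 1)) := fun g hg =>
    hU.integrable_comp_of_integrable hg
  have key2 : ∀ g : (ι → ℝ) → ℝ, Integrable g (gpi ι) →
      ∫ x, g x ∂(gpi ι) = ∫ x, ∫ t, g (Function.update x i t) ∂(gaussianReal 0 1) ∂(gpi ι) := by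
    intro g hg
    rw [← hU.map_eq, integral_map hU.aemeasurable (by rw [hU.map_eq]; exact hg.1), hU.map_eq,
      integral_prod _ (key g hg)]
  rw [key2 _ hxf, key2 _ hf']
  apply integral_congr_ae
  filter_upwards [(key _ hf).prod_right_ae, (key _ hxf).prod_right_ae, (key _ hf').prod_right_ae]
    with x h1 h2 h3
  simp only [Function.update_self] at h2 ⊢
  refine gauss_ibp (fun t => f (Function.update x i t)) _ (fun t => ?_) h1 h2 h3
  have := hd (Function.update x i t)
  simpa using this

/-- smoothed norm -/
noncomputable def sN {n : ℕ} (δ : ℝ) (a : Fin n → ℝ) : ℝ := Real.sqrt (δ ^ 2 + ∑ j, a j ^ 2)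
/-- partition function -/
noncomputable def sm {q : ℕ} (β : ℝ) (y : Fin q → ℝ) : ℝ := ∑ t, Real.exp (-β * y t)
/-- replicated functional -/
noncomputable def GG {K q : ℕ} (ρ β : ℝ) (y : Fin K → Fin q → ℝ) : ℝ :=
  Real.exp (ρ * ∑ k, Real.log (sm β (y k)))
/-- Gibbs weights -/
noncomputable def ww {q : ℕ} (β : ℝ) (y : Fin q → ℝ) (t : Fin q) : ℝ :=
  Real.exp (-β * y t) / sm β y
/-- normal direction -/
noncomputable def nn {n : ℕ} (δ : ℝ) (a : Fin n → ℝ) (j : Fin n) : ℝ := a j / sN δ a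

section det
variable {K q n : ℕ}

lemma sN_arg_pos {δ : ℝ} (hδ : 0 < δ) (a : Fin n → ℝ) : 0 < δ ^ 2 + ∑ j, a j ^ 2 := by
  have : 0 ≤ ∑ j, a j ^ 2 := Finset.sum_nonneg fun j _ => sq_nonneg _
  positivity

lemma sN_pos {δ : ℝ} (hδ : 0 < δ) (a : Fin n → ℝ) : 0 < sN δ a :=
  Real.sqrt_pos.2 (sN_arg_pos hδ a)

lemma sN_ge {δ : ℝ} (hδ : 0 < δ) (a : Fin n → ℝ) : δ ≤ sN δ a := by
  apply Real.le_sqrt_of_sq_le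
  have : 0 ≤ ∑ j, a j ^ 2 := Finset.sum_nonneg fun j _ => sq_nonneg _
  linarith

lemma sN_sq {δ : ℝ} (hδ : 0 < δ) (a : Fin n → ℝ) : sN δ a ^ 2 = δ ^ 2 + ∑ j, a j ^ 2 :=
  Real.sq_sqrt (sN_arg_pos hδ a).le

lemma nn_sq_sum {δ : ℝ} (hδ : 0 < δ) (a : Fin n → ℝ) : ∑ j, nn δ a j ^ 2 ≤ 1 := by
  unfold nn
  simp_rw [div_pow]
  rw [← Finset.sum_div, div_le_one (by have := sN_pos hδ a; positivity), sN_sq hδ]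
  nlinarith [sq_nonneg δ]

lemma nn_abs {δ : ℝ} (hδ : 0 < δ) (a : Fin n → ℝ) (j : Fin n) : |nn δ a j| ≤ 1 := by
  rw [← sq_le_one_iff_abs_le_one]
  exact (Finset.single_le_sum (f := fun j => nn δ a j ^ 2) (fun _ _ => sq_nonneg _)
    (Finset.mem_univ j)).trans (nn_sq_sum hδ a)

lemma abs_dot_le_one (u v : Fin n → ℝ) (hu : ∑ j, u j ^ 2 ≤ 1) (hv : ∑ j, v j ^ 2 ≤ 1) :
    |∑ j, u j * v j| ≤ 1 := by
  rw [← sq_le_one_iff_abs_le_one]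
  have h0 : 0 ≤ ∑ j, v j ^ 2 := Finset.sum_nonneg fun j _ => sq_nonneg _
  calc _ ≤ (∑ j, u j ^ 2) * ∑ j, v j ^ 2 := Finset.sum_mul_sq_le_sq_mul_sq _ _ _
    _ ≤ 1 * 1 := mul_le_mul hu hv h0 zero_le_one
    _ = 1 := one_mul _

lemma sm_pos [NeZero q] (β : ℝ) (y : Fin q → ℝ) : 0 < sm β y :=
  Finset.sum_pos (fun _ _ => Real.exp_pos _) ⟨0, Finset.mem_univ _⟩

lemma ww_nonneg [NeZero q] (β : ℝ) (y : Fin q → ℝ) (t : Fin q) : 0 ≤ ww β y t :=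
  div_nonneg (Real.exp_pos _).le (sm_pos β y).le

lemma ww_sum [NeZero q] (β : ℝ) (y : Fin q → ℝ) : ∑ t, ww β y t = 1 := by
  unfold ww
  rw [← Finset.sum_div]
  exact div_self (sm_pos β y).ne'

lemma ww_le_one [NeZero q] (β : ℝ) (y : Fin q → ℝ) (t : Fin q) : ww β y t ≤ 1 := by
  rw [← ww_sum β y]
  exact Finset.single_le_sum (f := fun t => ww β y t) (fun t _ => ww_nonneg β y t)
    (Finset.mem_univ t)

lemma GG_pos (ρ β : ℝ) (y : Fin K → Fin q → ℝ) : 0 < GG ρ β y := Real.exp_pos _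

lemma hasDerivAt_sN {δ : ℝ} (hδ : 0 < δ) {a : ℝ → Fin n → ℝ} {a' : Fin n → ℝ} {τ : ℝ}
    (ha : ∀ j, HasDerivAt (fun s => a s j) (a' j) τ) :
    HasDerivAt (fun s => sN δ (a s)) (∑ j, nn δ (a τ) j * a' j) τ := by
  have h1 : HasDerivAt (fun s => δ ^ 2 + ∑ j, a s j ^ 2) (∑ j, 2 * a τ j * a' j) τ := by
    apply HasDerivAt.const_add
    apply HasDerivAt.fun_sum
    intro j _
    refine ((ha j).fun_pow 2).congr_deriv ?_
    simp
  refine (h1.sqrt (sN_arg_pos hδ _).ne').congr_deriv ?_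
  unfold nn
  rw [Finset.sum_div]
  apply Finset.sum_congr rfl
  intro j _
  have := (sN_pos hδ (a τ)).ne'
  unfold sN at *
  field_simp

lemma hasDerivAt_nn {δ : ℝ} (hδ : 0 < δ) {a : ℝ → Fin n → ℝ} {a' : Fin n → ℝ} {τ : ℝ}
    (ha : ∀ j, HasDerivAt (fun s => a s j) (a' j) τ) (j : Fin n) :
    HasDerivAt (fun s => nn δ (a s) j)
      ((a' j - nn δ (a τ) j * ∑ l, nn δ (a τ) l * a' l) / sN δ (a τ)) τ := by
  have h0 := (sN_pos hδ (a τ)).ne'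
  refine ((ha j).fun_div (hasDerivAt_sN hδ ha) h0).congr_deriv ?_
  generalize ∑ l, nn δ (a τ) l * a' l = c
  unfold nn
  field_simp

lemma hasDerivAt_sm {β : ℝ} {y : ℝ → Fin q → ℝ} {y' : Fin q → ℝ} {τ : ℝ}
    (hy : ∀ t, HasDerivAt (fun s => y s t) (y' t) τ) :
    HasDerivAt (fun s => sm β (y s)) (∑ t, Real.exp (-β * y τ t) * (-β * y' t)) τ := by
  unfold sm
  apply HasDerivAt.fun_sum
  intro t _
  exact ((hy t).const_mul (-β)).exp

lemma sm_deriv_div [NeZero q] (β : ℝ) (y y' : Fin q → ℝ) :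
    (∑ t, Real.exp (-β * y t) * (-β * y' t)) = sm β y * (-β * ∑ t, ww β y t * y' t) := by
  have h0 := (sm_pos β y).ne'
  rw [Finset.mul_sum, Finset.mul_sum]
  apply Finset.sum_congr rfl
  intro t _
  unfold ww
  field_simp

lemma hasDerivAt_ww [NeZero q] {β : ℝ} {y : ℝ → Fin q → ℝ} {y' : Fin q → ℝ} {τ : ℝ}
    (hy : ∀ t, HasDerivAt (fun s => y s t) (y' t) τ) (t : Fin q) :
    HasDerivAt (fun s => ww β (y s) t)
      (-β * (ww β (y τ) t * (y' t - ∑ t', ww β (y τ) t' * y' t'))) τ := by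
  have h0 := (sm_pos β (y τ)).ne'
  refine ((((hy t).const_mul (-β)).exp).fun_div (hasDerivAt_sm hy) h0).congr_deriv ?_
  rw [sm_deriv_div]
  generalize ∑ t', ww β (y τ) t' * y' t' = c
  unfold ww
  field_simp
  ring

lemma hasDerivAt_GG [NeZero q] {ρ β : ℝ} {y : ℝ → Fin K → Fin q → ℝ} {y' : Fin K → Fin q → ℝ}
    {τ : ℝ} (hy : ∀ k t, HasDerivAt (fun s => y s k t) (y' k t) τ) :
    HasDerivAt (fun s => GG ρ β (y s))
      (-(ρ * β) * (GG ρ β (y τ) * ∑ k, ∑ t, ww β (y τ k) t * y' k t)) τ := by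
  have h1 : HasDerivAt (fun s => ρ * ∑ k, Real.log (sm β (y s k)))
      (ρ * ∑ k, (-β * ∑ t, ww β (y τ k) t * y' k t)) τ := by
    apply HasDerivAt.const_mul
    apply HasDerivAt.fun_sum
    intro k _
    have h0 := (sm_pos β (y τ k)).ne'
    refine ((hasDerivAt_sm (hy k)).log h0).congr_deriv ?_
    rw [sm_deriv_div]
    field_simp
  refine h1.exp.congr_deriv ?_
  rw [← Finset.mul_sum]
  unfold GG
  ring

/-- energies -/
noncomputable def yy (δ : ℝ) (a : Fin K → Fin q → Fin n → ℝ) (b : Fin K → Fin q → ℝ)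
    (k : Fin K) (t : Fin q) : ℝ := sN δ (a k t) + b k t

lemma hasDerivAt_yy {δ : ℝ} (hδ : 0 < δ) {a : ℝ → Fin K → Fin q → Fin n → ℝ}
    {b : ℝ → Fin K → Fin q → ℝ} {a' : Fin K → Fin q → Fin n → ℝ} {b' : Fin K → Fin q → ℝ} {τ : ℝ}
    (ha : ∀ k t j, HasDerivAt (fun s => a s k t j) (a' k t j) τ)
    (hb : ∀ k t, HasDerivAt (fun s => b s k t) (b' k t) τ) (k : Fin K) (t : Fin q) :
    HasDerivAt (fun s => yy δ (a s) (b s) k t)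
      (∑ j, nn δ (a τ k t) j * a' k t j + b' k t) τ :=
  (hasDerivAt_sN hδ (ha k t)).fun_add (hb k t)

/-- the first-derivative functional -/
noncomputable def ff (δ ρ β : ℝ) (P : Fin K → Fin q → Fin n → ℝ) (Q : Fin K → Fin q → ℝ)
    (a : Fin K → Fin q → Fin n → ℝ) (b : Fin K → Fin q → ℝ) : ℝ :=
  GG ρ β (yy δ a b) * ∑ k, ∑ t, ww β (yy δ a b k) t * (∑ j, nn δ (a k t) j * P k t j + Q k t)

/-- second derivative functional -/
noncomputable def ff' (δ ρ β : ℝ) (P : Fin K → Fin q → Fin n → ℝ) (Q : Fin K → Fin q → ℝ)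
    (a' : Fin K → Fin q → Fin n → ℝ) (b' : Fin K → Fin q → ℝ)
    (a : Fin K → Fin q → Fin n → ℝ) (b : Fin K → Fin q → ℝ) : ℝ :=
  -(ρ * β) * (GG ρ β (yy δ a b) *
      ∑ k, ∑ t, ww β (yy δ a b k) t * (∑ j, nn δ (a k t) j * a' k t j + b' k t)) *
    (∑ k, ∑ t, ww β (yy δ a b k) t * (∑ j, nn δ (a k t) j * P k t j + Q k t)) +
  GG ρ β (yy δ a b) * ∑ k, ∑ t,
    (-β * (ww β (yy δ a b k) t * ((∑ j, nn δ (a k t) j * a' k t j + b' k t) -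
      ∑ t', ww β (yy δ a b k) t' * (∑ j, nn δ (a k t') j * a' k t' j + b' k t'))) *
      (∑ j, nn δ (a k t) j * P k t j + Q k t) +
    ww β (yy δ a b k) t * ∑ j,
      (a' k t j - nn δ (a k t) j * ∑ l, nn δ (a k t) l * a' k t l) / sN δ (a k t) * P k t j)

lemma hasDerivAt_ff [NeZero q] {δ ρ β : ℝ} (hδ : 0 < δ) {P : Fin K → Fin q → Fin n → ℝ}
    {Q : Fin K → Fin q → ℝ} {a : ℝ → Fin K → Fin q → Fin n → ℝ}
    {b : ℝ → Fin K → Fin q → ℝ} {a' : Fin K → Fin q → Fin n → ℝ} {b' : Fin K → Fin q → ℝ} {τ : ℝ}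
    (ha : ∀ k t j, HasDerivAt (fun s => a s k t j) (a' k t j) τ)
    (hb : ∀ k t, HasDerivAt (fun s => b s k t) (b' k t) τ) :
    HasDerivAt (fun s => ff δ ρ β P Q (a s) (b s)) (ff' δ ρ β P Q a' b' (a τ) (b τ)) τ := by
  have hy := hasDerivAt_yy hδ ha hb
  refine (hasDerivAt_GG hy).fun_mul ?_
  apply HasDerivAt.fun_sum
  intro k _
  apply HasDerivAt.fun_sum
  intro t _
  refine (hasDerivAt_ww (hy k) t).fun_mul ?_
  apply HasDerivAt.add_const
  apply HasDerivAt.fun_sum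
  intro j _
  exact (hasDerivAt_nn hδ (ha k t) j).mul_const _

lemma GG_le [NeZero q] {ρ β L : ℝ} (hρ : 0 ≤ ρ) (hβ : 0 ≤ β) (y : Fin K → Fin q → ℝ)
    (hy : ∀ k t, -L ≤ y k t) :
    GG ρ β y ≤ Real.exp (ρ * (K * (Real.log q))) * Real.exp (ρ * (K * β) * L) := by
  have hq : (0 : ℝ) < q := by exact_mod_cast Nat.pos_of_ne_zero (NeZero.ne q)
  rw [← Real.exp_add]
  unfold GG
  rw [Real.exp_le_exp]
  have : ∑ k, Real.log (sm β (y k)) ≤ ∑ k : Fin K, (Real.log q + β * L) := by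
    apply Finset.sum_le_sum
    intro k _
    rw [Real.log_le_iff_le_exp (sm_pos _ _), Real.exp_add, Real.exp_log hq]
    calc sm β (y k) ≤ ∑ t : Fin q, Real.exp (β * L) := by
          apply Finset.sum_le_sum
          intro t _
          rw [Real.exp_le_exp]
          nlinarith [hy k t]
      _ = _ := by simp
  calc _ ≤ ρ * ∑ k : Fin K, (Real.log q + β * L) := by gcongr
    _ = _ := by simp; ring

lemma alg [NeZero q] {ε β : ℝ} (hε : 0 ≤ ε) (hεβ : ε ≤ β) (w : Fin K → Fin q → ℝ)
    (hw : ∀ k t, 0 ≤ w k t) (hws : ∀ k, ∑ t, w k t = 1)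
    (R : Fin K → Fin q → Fin K → Fin q → ℝ)
    (h1 : ∀ k t, R k t k t = -1) (h2 : ∀ k t t', -1 ≤ R k t k t')
    (h3 : ∀ k t k' t', k ≠ k' → R k t k' t' ≤ 1) :
    ε * (ε * ∑ k', ∑ t', ∑ k, ∑ t, w k' t' * w k t * R k' t' k t +
      β * ∑ k, ∑ t, w k t * (R k t k t - ∑ t', w k t' * R k t' k t)) ≤ ε ^ 2 * K ^ 2 := by
  set Q : Fin K → Fin K → ℝ := fun k' k => ∑ t', ∑ t, w k' t' * w k t * R k' t' k t with hQ
  have hw1 : ∀ k k' : Fin K, ∑ t', ∑ t, w k' t' * w k t = 1 := by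
    intro k k'
    simp_rw [← Finset.mul_sum, hws, mul_one]
    exact hws k'
  have hQ1 : ∀ k' k, k' ≠ k → Q k' k ≤ 1 := by
    intro k' k h
    rw [← hw1 k k']
    refine Finset.sum_le_sum fun t' _ => Finset.sum_le_sum fun t _ => ?_
    have := mul_nonneg (hw k' t') (hw k t)
    nlinarith [h3 k' t' k t h]
  have hQ2 : ∀ k, -1 ≤ Q k k := by
    intro k
    rw [← hw1 k k, ← Finset.sum_neg_distrib]
    refine Finset.sum_le_sum fun t' _ => ?_
    rw [← Finset.sum_neg_distrib]
    refine Finset.sum_le_sum fun t _ => ?_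
    have := mul_nonneg (hw k t') (hw k t)
    nlinarith [h2 k t' t]
  have e1 : ∑ k', ∑ t', ∑ k, ∑ t, w k' t' * w k t * R k' t' k t = ∑ k', ∑ k, Q k' k := by
    refine Finset.sum_congr rfl fun k' _ => ?_
    rw [Finset.sum_comm]
  have e2 : ∀ k, ∑ t, w k t * (R k t k t - ∑ t', w k t' * R k t' k t) = -1 - Q k k := by
    intro k
    simp_rw [h1, mul_sub, Finset.sum_sub_distrib, ← Finset.sum_mul, hws, one_mul]
    congr 1
    rw [hQ]
    simp only
    rw [Finset.sum_comm]
    refine Finset.sum_congr rfl fun t _ => ?_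
    rw [Finset.mul_sum]
    refine Finset.sum_congr rfl fun t' _ => ?_
    ring
  rw [e1]
  simp_rw [e2]
  have e3 : ∑ k : Fin K, (-1 - Q k k) = ∑ k' : Fin K, ∑ k, if k' = k then (-1 - Q k' k) else 0 := by
    simp
  rw [e3, Finset.mul_sum, Finset.mul_sum, ← Finset.sum_add_distrib, Finset.mul_sum]
  calc _ ≤ ∑ k' : Fin K, ∑ k : Fin K, ε ^ 2 := by
        refine Finset.sum_le_sum fun k' _ => ?_
        rw [Finset.mul_sum, Finset.mul_sum, ← Finset.sum_add_distrib, Finset.mul_sum]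
        refine Finset.sum_le_sum fun k _ => ?_
        split_ifs with h
        · subst h
          have := hQ2 k'
          nlinarith [mul_nonneg hε (mul_nonneg (sub_nonneg.2 hεβ) (by linarith : 0 ≤ 1 + Q k' k')),
            sq_nonneg ε]
        · have := hQ1 k' k h
          nlinarith [sq_nonneg ε]
    _ = _ := by simp; ring

end det

section cont
variable {K q n : ℕ} {X : Type} [TopologicalSpace X]

lemma cont_sN {δ : ℝ} {a : X → Fin n → ℝ} (ha : Continuous a) :
    Continuous fun x => sN δ (a x) := by
  unfold sN; fun_prop

lemma cont_nn {δ : ℝ} (hδ : 0 < δ) {a : X → Fin n → ℝ} (ha : Continuous a) (j : Fin n) :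
    Continuous fun x => nn δ (a x) j := by
  unfold nn
  exact Continuous.div (by fun_prop) (cont_sN ha) (fun x => (sN_pos hδ _).ne')

lemma cont_sm {β : ℝ} {y : X → Fin q → ℝ} (hy : Continuous y) :
    Continuous fun x => sm β (y x) := by
  unfold sm; fun_prop

lemma cont_ww [NeZero q] {β : ℝ} {y : X → Fin q → ℝ} (hy : Continuous y) (t : Fin q) :
    Continuous fun x => ww β (y x) t := by
  unfold ww
  exact Continuous.div (by fun_prop) (cont_sm hy) (fun x => (sm_pos _ _).ne')

lemma cont_GG [NeZero q] {ρ β : ℝ} {y : X → Fin K → Fin q → ℝ} (hy : Continuous y) :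
    Continuous fun x => GG ρ β (y x) := by
  unfold GG
  refine Real.continuous_exp.comp (continuous_const.mul (continuous_finsetSum _ fun k _ => ?_))
  exact Continuous.log (cont_sm (by fun_prop)) (fun x => (sm_pos _ _).ne')

lemma cont_yy {δ : ℝ} {a : X → Fin K → Fin q → Fin n → ℝ} {b : X → Fin K → Fin q → ℝ}
    (ha : Continuous a) (hb : Continuous b) : Continuous fun x => yy δ (a x) (b x) := by
  refine continuous_pi fun k => continuous_pi fun t => ?_
  unfold yy
  exact (cont_sN (by fun_prop)).add (by fun_prop)

lemma cont_ff [NeZero q] {δ ρ β : ℝ} (hδ : 0 < δ) {P : Fin K → Fin q → Fin n → ℝ}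
    {Q : Fin K → Fin q → ℝ} {a : X → Fin K → Fin q → Fin n → ℝ} {b : X → Fin K → Fin q → ℝ}
    (ha : Continuous a) (hb : Continuous b) : Continuous fun x => ff δ ρ β P Q (a x) (b x) := by
  have hy := cont_yy (δ := δ) ha hb
  have hG := cont_GG (ρ := ρ) (β := β) hy
  have hw : ∀ k t, Continuous fun x => ww β (yy δ (a x) (b x) k) t :=
    fun k t => cont_ww (by fun_prop) t
  have hn : ∀ k t j, Continuous fun x => nn δ (a x k t) j :=
    fun k t j => cont_nn hδ (by fun_prop) j
  unfold ff
  fun_prop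

lemma cont_ff' [NeZero q] {δ ρ β : ℝ} (hδ : 0 < δ) {P : Fin K → Fin q → Fin n → ℝ}
    {Q : Fin K → Fin q → ℝ} {a' : Fin K → Fin q → Fin n → ℝ} {b' : Fin K → Fin q → ℝ}
    {a : X → Fin K → Fin q → Fin n → ℝ} {b : X → Fin K → Fin q → ℝ}
    (ha : Continuous a) (hb : Continuous b) :
    Continuous fun x => ff' δ ρ β P Q a' b' (a x) (b x) := by
  have hy := cont_yy (δ := δ) ha hb
  have hG := cont_GG (ρ := ρ) (β := β) hy
  have hw : ∀ k t, Continuous fun x => ww β (yy δ (a x) (b x) k) t :=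
    fun k t => cont_ww (by fun_prop) t
  have hn : ∀ k t j, Continuous fun x => nn δ (a x k t) j :=
    fun k t j => cont_nn hδ (by fun_prop) j
  have hN : ∀ k t, Continuous fun x => (sN δ (a x k t))⁻¹ := fun k t =>
    Continuous.inv₀ (cont_sN (by fun_prop)) (fun x => (sN_pos hδ _).ne')
  unfold ff'
  simp only [div_eq_mul_inv]
  fun_prop

end cont

section bounds
variable {K q n : ℕ}

lemma abs_sum_le_card {ι : Type} [Fintype ι] (f : ι → ℝ) (c : ℝ) (h : ∀ i, |f i| ≤ c) :
    |∑ i, f i| ≤ Fintype.card ι * c := by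
  calc _ ≤ ∑ i, |f i| := Finset.abs_sum_le_sum_abs _ _
    _ ≤ ∑ i : ι, c := Finset.sum_le_sum fun i _ => h i
    _ = _ := by simp

lemma bd_lin {δ : ℝ} (hδ : 0 < δ) (a P : Fin n → ℝ) (Q : ℝ) (hP : ∀ j, |P j| ≤ 1)
    (hQ : |Q| ≤ 1) : |∑ j, nn δ a j * P j + Q| ≤ n + 1 := by
  have : |∑ j, nn δ a j * P j| ≤ n * 1 := by
    have := abs_sum_le_card (fun j => nn δ a j * P j) 1 (fun j => by
      rw [abs_mul]; exact mul_le_one₀ (nn_abs hδ a j) (abs_nonneg _) (hP j))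
    simpa using this
  exact (abs_add_le _ _).trans (by linarith)

lemma bd_w [NeZero q] (β : ℝ) (y : Fin q → ℝ) (v : Fin q → ℝ) (c : ℝ) (hc : ∀ t, |v t| ≤ c) :
    |∑ t, ww β y t * v t| ≤ c := by
  calc _ ≤ ∑ t, |ww β y t * v t| := Finset.abs_sum_le_sum_abs _ _
    _ ≤ ∑ t, ww β y t * c := Finset.sum_le_sum fun t _ => by
        rw [abs_mul, abs_of_nonneg (ww_nonneg β y t)]
        exact mul_le_mul_of_nonneg_left (hc t) (ww_nonneg β y t)
    _ = c := by rw [← Finset.sum_mul, ww_sum, one_mul]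

lemma bd_ww [NeZero q] (β : ℝ) (y : Fin K → Fin q → ℝ) (v : Fin K → Fin q → ℝ) (c : ℝ)
    (hc : ∀ k t, |v k t| ≤ c) :
    |∑ k, ∑ t, ww β (y k) t * v k t| ≤ K * c := by
  have := abs_sum_le_card (fun k => ∑ t, ww β (y k) t * v k t) c
    (fun k => bd_w β (y k) (v k) c (hc k))
  simpa using this

lemma bd_ff [NeZero q] {δ : ℝ} (hδ : 0 < δ) (ρ β : ℝ) (P : Fin K → Fin q → Fin n → ℝ)
    (Q : Fin K → Fin q → ℝ) (hP : ∀ k t j, |P k t j| ≤ 1) (hQ : ∀ k t, |Q k t| ≤ 1)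
    (a : Fin K → Fin q → Fin n → ℝ) (b : Fin K → Fin q → ℝ) :
    |ff δ ρ β P Q a b| ≤ (K * (n + 1)) * GG ρ β (yy δ a b) := by
  unfold ff
  rw [abs_mul, abs_of_pos (GG_pos _ _ _), mul_comm]
  apply mul_le_mul_of_nonneg_right _ (GG_pos _ _ _).le
  exact bd_ww β (yy δ a b) _ _ (fun k t => bd_lin hδ _ _ _ (hP k t) (hQ k t))

lemma bd_ff' [NeZero q] {δ : ℝ} (hδ : 0 < δ) (ρ β : ℝ) : ∃ c : ℝ,
    ∀ (P : Fin K → Fin q → Fin n → ℝ)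
    (Q : Fin K → Fin q → ℝ) (_ : ∀ k t j, |P k t j| ≤ 1) (_ : ∀ k t, |Q k t| ≤ 1)
    (a' : Fin K → Fin q → Fin n → ℝ)
    (b' : Fin K → Fin q → ℝ) (_ : ∀ k t j, |a' k t j| ≤ 1) (_ : ∀ k t, |b' k t| ≤ 1)
    (a : Fin K → Fin q → Fin n → ℝ) (b : Fin K → Fin q → ℝ),
    |ff' δ ρ β P Q a' b' a b| ≤ c * GG ρ β (yy δ a b) := by
  refine ⟨|ρ * β| * (K * (n + 1)) * (K * (n + 1)) +
    (K * (q * (|β| * (1 * ((n + 1) + (n + 1))) * (n + 1) + 1 * (n * ((1 + 1 * (n * 1)) / δ * 1))))), ?_⟩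
  intro P Q hP hQ a' b' ha' hb' a b
  have hG := GG_pos ρ β (yy δ a b)
  have hv : ∀ k t, |∑ j, nn δ (a k t) j * P k t j + Q k t| ≤ n + 1 :=
    fun k t => bd_lin hδ _ _ _ (hP k t) (hQ k t)
  have hu : ∀ k t, |∑ j, nn δ (a k t) j * a' k t j + b' k t| ≤ n + 1 :=
    fun k t => bd_lin hδ _ _ _ (ha' k t) (hb' k t)
  have hw : ∀ k t, |ww β (yy δ a b k) t| ≤ 1 := fun k t => by
    rw [abs_of_nonneg (ww_nonneg _ _ _)]; exact ww_le_one _ _ _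
  have hn1 : (0 : ℝ) ≤ n + 1 := by positivity
  unfold ff'
  rw [add_mul]
  refine (abs_add_le _ _).trans (add_le_add ?_ ?_)
  · rw [abs_mul, abs_mul, abs_mul, abs_neg, abs_of_pos hG]
    calc _ ≤ |ρ * β| * (GG ρ β (yy δ a b) * (K * (n + 1))) * (K * (n + 1)) := by
          gcongr
          · exact bd_ww β (yy δ a b) _ _ hu
          · exact bd_ww β (yy δ a b) _ _ hv
      _ = _ := by ring
  · rw [abs_mul, abs_of_pos hG, mul_comm]
    apply mul_le_mul_of_nonneg_right _ hG.le
    refine (abs_sum_le_card _ (q * (|β| * (1 * ((n + 1) + (n + 1))) * (n + 1) + 1 * (n * ((1 + 1 * (n * 1)) / δ * 1))))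
      (fun k => ?_)).trans_eq (by simp)
    refine (abs_sum_le_card _ ((|β| * (1 * ((n + 1) + (n + 1))) * (n + 1) + 1 * (n * ((1 + 1 * (n * 1)) / δ * 1))))
      (fun t => ?_)).trans_eq (by simp)
    refine (abs_add_le _ _).trans (add_le_add ?_ ?_)
    · rw [abs_mul, abs_mul, abs_mul, abs_neg]
      gcongr
      · exact hw k t
      · refine (abs_sub _ _).trans (add_le_add (hu k t) ?_)
        exact bd_w β _ _ _ (hu k)
      · exact hv k t
    · rw [abs_mul]
      gcongr
      · exact hw k t
      · refine (abs_sum_le_card _ ((1 + 1 * (n * 1)) / δ * 1) (fun j => ?_)).trans_eq (by simp)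
        rw [abs_mul, abs_div, abs_of_pos (sN_pos hδ _)]
        gcongr
        · refine (abs_sub _ _).trans (add_le_add (ha' k t j) ?_)
          rw [abs_mul]
          gcongr
          · exact nn_abs hδ _ _
          · refine (abs_sum_le_card _ 1 (fun l => ?_)).trans_eq (by simp)
            rw [abs_mul]; exact mul_le_one₀ (nn_abs hδ _ _) (abs_nonneg _) (ha' k t l)
        · exact sN_ge hδ _
        · exact hP k t j

lemma ff_lin {I : Type} [Fintype I] {δ ρ β : ℝ} (P : Fin K → Fin q → Fin n → I → ℝ)
    (Q : Fin K → Fin q → I → ℝ) (x : I → ℝ)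
    (a : Fin K → Fin q → Fin n → ℝ) (b : Fin K → Fin q → ℝ) :
    ff δ ρ β (fun k t j => ∑ i, P k t j i * x i) (fun k t => ∑ i, Q k t i * x i) a b =
      ∑ i, x i * ff δ ρ β (fun k t j => P k t j i) (fun k t => Q k t i) a b := by
  unfold ff
  have : ∀ i, x i * (GG ρ β (yy δ a b) * ∑ k, ∑ t, ww β (yy δ a b k) t *
      (∑ j, nn δ (a k t) j * P k t j i + Q k t i)) = GG ρ β (yy δ a b) * ∑ k, ∑ t,
      (ww β (yy δ a b k) t * (∑ j, nn δ (a k t) j * (P k t j i * x i) + Q k t i * x i)) := by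
    intro i
    rw [mul_left_comm, Finset.mul_sum]
    congr 1
    refine Finset.sum_congr rfl fun k _ => ?_
    rw [Finset.mul_sum]
    refine Finset.sum_congr rfl fun t _ => ?_
    rw [mul_left_comm, mul_add, Finset.mul_sum]
    congr 2
    · refine Finset.sum_congr rfl fun j _ => ?_
      ring
    · ring
  simp_rw [this]
  rw [← Finset.mul_sum]
  congr 1
  symm
  rw [Finset.sum_comm]
  refine Finset.sum_congr rfl fun k _ => ?_
  rw [Finset.sum_comm]
  refine Finset.sum_congr rfl fun t _ => ?_
  rw [← Finset.mul_sum]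
  congr 1
  rw [Finset.sum_add_distrib, Finset.sum_comm]
  congr 1
  refine Finset.sum_congr rfl fun j _ => ?_
  rw [Finset.mul_sum]

lemma sum_ff' {I : Type} [Fintype I] {δ ρ β : ℝ} (P A : Fin K → Fin q → Fin n → I → ℝ)
    (Q B : Fin K → Fin q → I → ℝ)
    (hz : ∀ k t j l, ∑ i, A k t j i * P k t l i = 0)
    (a : Fin K → Fin q → Fin n → ℝ) (b : Fin K → Fin q → ℝ)
    (R : Fin K → Fin q → Fin K → Fin q → ℝ)
    (hR : ∀ k t k' t', R k t k' t' = ∑ i, (∑ j, nn δ (a k t) j * A k t j i + B k t i) *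
      (∑ j, nn δ (a k' t') j * P k' t' j i + Q k' t' i)) :
    ∑ i, ff' δ ρ β (fun k t j => P k t j i) (fun k t => Q k t i)
      (fun k t j => A k t j i) (fun k t => B k t i) a b =
    -(GG ρ β (yy δ a b) * (ρ * β * ∑ k', ∑ t', ∑ k, ∑ t,
        ww β (yy δ a b k') t' * ww β (yy δ a b k) t * R k' t' k t +
      β * ∑ k, ∑ t, ww β (yy δ a b k) t * (R k t k t -
        ∑ t', ww β (yy δ a b k) t' * R k t' k t))) := by
  unfold ff'
  generalize GG ρ β (yy δ a b) = G
  generalize hw : (fun k t => ww β (yy δ a b k) t) = w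
  have hw' : ∀ k t, ww β (yy δ a b k) t = w k t := fun k t => by rw [← hw]
  simp_rw [hw']
  generalize hu : (fun k t i => ∑ j, nn δ (a k t) j * A k t j i + B k t i) = u
  have hu' : ∀ k t i, ∑ j, nn δ (a k t) j * A k t j i + B k t i = u k t i :=
    fun k t i => by rw [← hu]
  generalize hv : (fun k t i => ∑ j, nn δ (a k t) j * P k t j i + Q k t i) = v
  have hv' : ∀ k t i, ∑ j, nn δ (a k t) j * P k t j i + Q k t i = v k t i :=
    fun k t i => by rw [← hv]
  simp_rw [hu', hv'] at hR ⊢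
  -- vanishing term
  have hz2 : ∀ k t, ∑ i, ∑ j, (A k t j i - nn δ (a k t) j * ∑ l, nn δ (a k t) l * A k t l i) /
      sN δ (a k t) * P k t j i = 0 := by
    intro k t
    rw [Finset.sum_comm]
    refine Finset.sum_eq_zero fun j _ => ?_
    have e : ∀ i, (A k t j i - nn δ (a k t) j * ∑ l, nn δ (a k t) l * A k t l i) /
      sN δ (a k t) * P k t j i = (sN δ (a k t))⁻¹ * (A k t j i * P k t j i) -
        ∑ l, (sN δ (a k t))⁻¹ * nn δ (a k t) j * nn δ (a k t) l * (A k t l i * P k t j i) := by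
      intro i
      have : ∑ l, (sN δ (a k t))⁻¹ * nn δ (a k t) j * nn δ (a k t) l * (A k t l i * P k t j i) =
        (sN δ (a k t))⁻¹ * nn δ (a k t) j * P k t j i * ∑ l, nn δ (a k t) l * A k t l i := by
        rw [Finset.mul_sum]
        refine Finset.sum_congr rfl fun l _ => ?_
        ring
      rw [this]
      ring
    simp_rw [e]
    rw [Finset.sum_sub_distrib, ← Finset.mul_sum, hz, Finset.sum_comm]
    simp_rw [← Finset.mul_sum, hz]
    simp
  rw [Finset.sum_add_distrib]
  have t1 : ∑ i, -(ρ * β) * (G * ∑ k, ∑ t, w k t * u k t i) * (∑ k, ∑ t, w k t * v k t i) =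
      -(G * (ρ * β * ∑ k', ∑ t', ∑ k, ∑ t, w k' t' * w k t * R k' t' k t)) := by
    have : ∑ k', ∑ t', ∑ k, ∑ t, w k' t' * w k t * R k' t' k t =
        ∑ i, (∑ k, ∑ t, w k t * u k t i) * (∑ k, ∑ t, w k t * v k t i) := by
      symm
      simp_rw [hR, Finset.sum_mul, Finset.mul_sum]
      rw [Finset.sum_comm]
      refine Finset.sum_congr rfl fun k' _ => ?_
      rw [Finset.sum_comm]
      refine Finset.sum_congr rfl fun t' _ => ?_
      rw [Finset.sum_comm]
      refine Finset.sum_congr rfl fun k _ => ?_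
      rw [Finset.sum_comm]
      refine Finset.sum_congr rfl fun t _ => ?_
      refine Finset.sum_congr rfl fun i _ => ?_
      ring
    rw [this, Finset.mul_sum, Finset.mul_sum, ← Finset.sum_neg_distrib]
    refine Finset.sum_congr rfl fun i _ => ?_
    ring
  have t2 : ∑ i, G * ∑ k, ∑ t, (-β * (w k t * (u k t i - ∑ t', w k t' * u k t' i)) * v k t i +
      w k t * ∑ j, (A k t j i - nn δ (a k t) j * ∑ l, nn δ (a k t) l * A k t l i) /
      sN δ (a k t) * P k t j i) =
      -(G * (β * ∑ k, ∑ t, w k t * (R k t k t - ∑ t', w k t' * R k t' k t))) := by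
    rw [← Finset.mul_sum, ← mul_neg]
    congr 1
    rw [Finset.sum_comm, Finset.mul_sum, ← Finset.sum_neg_distrib]
    refine Finset.sum_congr rfl fun k _ => ?_
    rw [Finset.sum_comm, Finset.mul_sum, ← Finset.sum_neg_distrib]
    refine Finset.sum_congr rfl fun t _ => ?_
    rw [Finset.sum_add_distrib, ← Finset.mul_sum, hz2, mul_zero, add_zero]
    have : R k t k t - ∑ t', w k t' * R k t' k t =
        ∑ i, (u k t i - ∑ t', w k t' * u k t' i) * v k t i := by
      simp_rw [hR, sub_mul, Finset.sum_sub_distrib, Finset.sum_mul, Finset.mul_sum]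
      congr 1
      rw [Finset.sum_comm]
      refine Finset.sum_congr rfl fun i _ => Finset.sum_congr rfl fun t' _ => ?_
      ring
    rw [this, Finset.mul_sum, Finset.mul_sum, ← Finset.sum_neg_distrib]
    refine Finset.sum_congr rfl fun i _ => ?_
    ring
  rw [t1, t2]
  ring

end bounds

/-- index set of the Gaussian coordinates -/
abbrev II (n d K : ℕ) : Type := (Fin n × Fin d) ⊕ (Fin K × (Fin n ⊕ Fin d))

section path
variable {K q n d : ℕ}

/-- coefficients of the vector part -/
noncomputable def cA (T : Fin q → Fin d → ℝ) (S C : ℝ) (k : Fin K) (t : Fin q) (j : Fin n) :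
    II n d K → ℝ
  | .inl (j', l) => if j' = j then S * T t l else 0
  | .inr (k', .inl j') => if k' = k then (if j' = j then C else 0) else 0
  | .inr (_, .inr _) => 0

/-- coefficients of the scalar part -/
noncomputable def cB (n : ℕ) (T : Fin q → Fin d → ℝ) (C : ℝ) (k : Fin K) (t : Fin q) :
    II n d K → ℝ
  | .inl _ => 0
  | .inr (_, .inl _) => 0
  | .inr (k', .inr l) => if k' = k then -(C * T t l) else 0

lemma cA_abs (T : Fin q → Fin d → ℝ) (hT : ∀ t l, |T t l| ≤ 1) {S C : ℝ} (hS : |S| ≤ 1)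
    (hC : |C| ≤ 1) (k : Fin K) (t : Fin q) (j : Fin n) (i : II n d K) :
    |cA T S C k t j i| ≤ 1 := by
  rcases i with ⟨j', l⟩ | ⟨k', j' | l⟩
  · simp only [cA]
    split_ifs
    · rw [abs_mul]; exact mul_le_one₀ hS (abs_nonneg _) (hT t l)
    · simp
  · simp only [cA]
    split_ifs <;> simp [hC]
  · simp [cA]

lemma cB_abs (T : Fin q → Fin d → ℝ) (hT : ∀ t l, |T t l| ≤ 1) {C : ℝ}
    (hC : |C| ≤ 1) (k : Fin K) (t : Fin q) (i : II n d K) :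
    |cB n T C k t i| ≤ 1 := by
  rcases i with ⟨j', l⟩ | ⟨k', j' | l⟩
  · simp [cB]
  · simp [cB]
  · simp only [cB]
    split_ifs
    · rw [abs_neg, abs_mul]; exact mul_le_one₀ hC (abs_nonneg _) (hT t l)
    · simp

lemma cA_deriv (T : Fin q → Fin d → ℝ) (k : Fin K) (t : Fin q) (j : Fin n) (i : II n d K) (φ : ℝ) :
    HasDerivAt (fun s => cA T (Real.sin s) (Real.cos s) k t j i)
      (cA T (Real.cos φ) (-Real.sin φ) k t j i) φ := by
  rcases i with ⟨j', l⟩ | ⟨k', j' | l⟩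
  · simp only [cA]
    split_ifs
    · exact (Real.hasDerivAt_sin φ).mul_const _
    · exact hasDerivAt_const _ _
  · simp only [cA]
    split_ifs
    · exact Real.hasDerivAt_cos φ
    · exact hasDerivAt_const _ _
    · exact hasDerivAt_const _ _
  · exact hasDerivAt_const _ _

lemma cB_deriv (T : Fin q → Fin d → ℝ) (k : Fin K) (t : Fin q) (i : II n d K) (φ : ℝ) :
    HasDerivAt (fun s => cB n T (Real.cos s) k t i)
      (cB n T (-Real.sin φ) k t i) φ := by
  rcases i with ⟨j', l⟩ | ⟨k', j' | l⟩
  · exact hasDerivAt_const _ _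
  · exact hasDerivAt_const _ _
  · simp only [cB]
    split_ifs
    · exact ((Real.hasDerivAt_cos φ).mul_const _).neg
    · exact hasDerivAt_const _ _

lemma cA_zero (T : Fin q → Fin d → ℝ) (hT : ∀ t, ∑ l, T t l * T t l = 1) (S C : ℝ)
    (k : Fin K) (t : Fin q) (j l : Fin n) :
    ∑ i : II n d K, cA T S C k t j i * cA T C (-S) k t l i = 0 := by
  rw [Fintype.sum_sum_type, Fintype.sum_prod_type, Fintype.sum_prod_type]
  simp only [Fintype.sum_sum_type, cA]
  by_cases h : j = l
  · subst h
    simp only [ite_mul, zero_mul, mul_ite, mul_zero, Finset.sum_ite_irrel, Finset.sum_const_zero,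
      Finset.sum_ite_eq', Finset.mem_univ, if_true, Finset.sum_const_zero, add_zero]
    have : ∑ x, S * T t x * (C * T t x) = S * C * ∑ x, T t x * T t x := by
      rw [Finset.mul_sum]; exact Finset.sum_congr rfl fun x _ => by ring
    simp [this, hT]
    ring
  · have h2 : ∀ j' : Fin n, j' = j → ¬ j' = l := fun j' h1 h2 => h (h1.symm.trans h2)
    have e1 : ∀ (j' : Fin n) (a b : ℝ), (if j' = j then a else 0) * (if j' = l then b else 0) = 0 := by
      intro j' a b
      by_cases hj : j' = j
      · simp [h2 j' hj]
      · simp [hj]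
    have e2 : ∀ (k' : Fin K) (j' : Fin n) (a b : ℝ), (if k' = k then (if j' = j then a else 0) else 0)
        * (if k' = k then (if j' = l then b else 0) else 0) = 0 := by
      intro k' j' a b
      by_cases hk : k' = k
      · simp only [hk, if_true]; exact e1 j' a b
      · simp [hk]
    simp [e1, e2]

lemma cAB_R (T : Fin q → Fin d → ℝ) (S C S' C' : ℝ) (ν ν' : Fin n → ℝ)
    (k : Fin K) (t : Fin q) (k' : Fin K) (t' : Fin q) :
    ∑ i : II n d K, (∑ j, ν j * cA T S C k t j i + cB n T C k t i) *
      (∑ j, ν' j * cA T S' C' k' t' j i + cB n T C' k' t' i) =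
    S * S' * (∑ j, ν j * ν' j) * (∑ l, T t l * T t' l) +
    if k = k' then C * C' * (∑ j, ν j * ν' j) + C * C' * (∑ l, T t l * T t' l) else 0 := by
  rw [Fintype.sum_sum_type, Fintype.sum_prod_type, Fintype.sum_prod_type]
  simp only [Fintype.sum_sum_type, cA, cB, mul_ite, mul_zero, Finset.sum_ite_eq, Finset.mem_univ,
    if_true, add_zero, Finset.sum_ite_irrel, Finset.sum_const_zero, zero_add]
  congr 1
  · rw [mul_assoc, Finset.sum_mul, Finset.mul_sum]
    refine Finset.sum_congr rfl fun j _ => ?_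
    rw [Finset.mul_sum, Finset.mul_sum]
    refine Finset.sum_congr rfl fun l _ => ?_
    ring
  · by_cases h : k = k'
    · subst h
      simp only [if_true, ite_mul, zero_mul]
      rw [Finset.sum_eq_single k]
      · simp only [if_true]
        congr 1
        · rw [Finset.mul_sum]
          refine Finset.sum_congr rfl fun j _ => ?_
          ring
        · rw [Finset.mul_sum]
          refine Finset.sum_congr rfl fun j _ => ?_
          ring
      · intro b _ hb; simp [hb]
      · simp
    · simp only [h, if_false]
      refine Finset.sum_eq_zero fun k0 _ => ?_
      by_cases h0 : k0 = k
      · have : ¬ k0 = k' := fun h1 => h (h0.symm.trans h1)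
        simp [this]
      · simp [h0]

/-- vector part of the path -/
noncomputable def pa (T : Fin q → Fin d → ℝ) (φ : ℝ) (x : II n d K → ℝ) (k : Fin K) (t : Fin q)
    (j : Fin n) : ℝ := ∑ i, cA T (Real.sin φ) (Real.cos φ) k t j i * x i
/-- scalar part of the path -/
noncomputable def pb (T : Fin q → Fin d → ℝ) (φ : ℝ) (x : II n d K → ℝ) (k : Fin K) (t : Fin q) :
    ℝ := ∑ i, cB n T (Real.cos φ) k t i * x i
/-- the functional along the path -/
noncomputable def pF (T : Fin q → Fin d → ℝ) (δ ρ β φ : ℝ) (x : II n d K → ℝ) : ℝ :=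
  GG ρ β (yy δ (pa T φ x) (pb T φ x))

lemma cont_pa (T : Fin q → Fin d → ℝ) (φ : ℝ) :
    Continuous (fun x : II n d K → ℝ => pa T φ x) := by
  unfold pa
  refine continuous_pi fun k => continuous_pi fun t => continuous_pi fun j => ?_
  fun_prop

lemma cont_pb (T : Fin q → Fin d → ℝ) (φ : ℝ) :
    Continuous (fun x : II n d K → ℝ => pb T φ x) := by
  unfold pb
  refine continuous_pi fun k => continuous_pi fun t => ?_
  fun_prop

lemma pF_le [NeZero q] (T : Fin q → Fin d → ℝ) (hT : ∀ t l, |T t l| ≤ 1) {δ ρ β : ℝ} (hδ : 0 < δ)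
    (hρ : 0 ≤ ρ) (hβ : 0 ≤ β) (φ : ℝ) (x : II n d K → ℝ) :
    pF T δ ρ β φ x ≤ Real.exp (ρ * (K * (Real.log q))) *
      Real.exp (ρ * (K * β) * ∑ i, |x i|) := by
  refine GG_le hρ hβ _ fun k t => ?_
  have h1 := sN_pos hδ (pa T φ x k t)
  have h2 : |pb T φ x k t| ≤ ∑ i, |x i| := by
    unfold pb
    refine (Finset.abs_sum_le_sum_abs _ _).trans (Finset.sum_le_sum fun i _ => ?_)
    rw [abs_mul]
    exact mul_le_of_le_one_left (abs_nonneg _) (cB_abs T hT (Real.abs_cos_le_one φ) k t i)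
  have := (abs_le.1 h2).1
  unfold yy
  linarith

/-- coefficient form of the derivative functional -/
noncomputable def pf (T : Fin q → Fin d → ℝ) (δ ρ β φ : ℝ) (i : II n d K) (x : II n d K → ℝ) : ℝ :=
  ff δ ρ β (fun k t j => cA T (Real.cos φ) (-Real.sin φ) k t j i)
    (fun k t => cB n T (-Real.sin φ) k t i) (pa T φ x) (pb T φ x)

/-- its partial derivative -/
noncomputable def pf' (T : Fin q → Fin d → ℝ) (δ ρ β φ : ℝ) (i : II n d K) (x : II n d K → ℝ) : ℝ :=
  ff' δ ρ β (fun k t j => cA T (Real.cos φ) (-Real.sin φ) k t j i)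
    (fun k t => cB n T (-Real.sin φ) k t i)
    (fun k t j => cA T (Real.sin φ) (Real.cos φ) k t j i)
    (fun k t => cB n T (Real.cos φ) k t i) (pa T φ x) (pb T φ x)

lemma pF_deriv [NeZero q] (T : Fin q → Fin d → ℝ) {δ ρ β : ℝ} (hδ : 0 < δ) (φ : ℝ)
    (x : II n d K → ℝ) :
    HasDerivAt (fun s => pF T δ ρ β s x) (-(ρ * β) * ∑ i, x i * pf T δ ρ β φ i x) φ := by
  have ha : ∀ k t j, HasDerivAt (fun s => pa T s x k t j)
      (∑ i, cA T (Real.cos φ) (-Real.sin φ) k t j i * x i) φ := fun k t j =>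
    HasDerivAt.fun_sum fun i _ => (cA_deriv T k t j i φ).mul_const _
  have hb : ∀ k t, HasDerivAt (fun s => pb T s x k t)
      (∑ i, cB n T (-Real.sin φ) k t i * x i) φ := fun k t =>
    HasDerivAt.fun_sum fun i _ => (cB_deriv T k t i φ).mul_const _
  refine (hasDerivAt_GG (hasDerivAt_yy hδ ha hb)).congr_deriv ?_
  congr 1
  exact ff_lin (fun k t j i => cA T (Real.cos φ) (-Real.sin φ) k t j i)
    (fun k t i => cB n T (-Real.sin φ) k t i) x _ _

lemma pf_deriv [NeZero q] (T : Fin q → Fin d → ℝ) {δ ρ β : ℝ} (hδ : 0 < δ) (φ : ℝ)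
    (i : II n d K) (x : II n d K → ℝ) :
    HasDerivAt (fun s => pf T δ ρ β φ i (Function.update x i s)) (pf' T δ ρ β φ i x) (x i) := by
  have hup : ∀ l, HasDerivAt (fun s => Function.update x i s l)
      ((Pi.single i (1 : ℝ) : II n d K → ℝ) l) (x i) :=
    hasDerivAt_pi.1 (hasDerivAt_update x i (x i))
  have ha : ∀ k t j, HasDerivAt (fun s => pa T φ (Function.update x i s) k t j)
      (cA T (Real.sin φ) (Real.cos φ) k t j i) (x i) := fun k t j => by
    refine (HasDerivAt.fun_sum fun l _ => (hup l).const_mul _).congr_deriv ?_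
    simp [Pi.single_apply]
  have hb : ∀ k t, HasDerivAt (fun s => pb T φ (Function.update x i s) k t)
      (cB n T (Real.cos φ) k t i) (x i) := fun k t => by
    refine (HasDerivAt.fun_sum fun l _ => (hup l).const_mul _).congr_deriv ?_
    simp [Pi.single_apply]
  have := hasDerivAt_ff (ρ := ρ) (β := β)
    (P := fun k t j => cA T (Real.cos φ) (-Real.sin φ) k t j i)
    (Q := fun k t => cB n T (-Real.sin φ) k t i) hδ ha hb
  simp only [Function.update_eq_self] at this
  exact this

lemma pf'_sum [NeZero q] (T : Fin q → Fin d → ℝ) (hT : ∀ t, ∑ l, T t l * T t l = 1)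
    {δ ρ β : ℝ} (hδ : 0 < δ) (hρ : 0 ≤ ρ) (hρ1 : ρ ≤ 1) (hβ : 0 ≤ β) {φ : ℝ}
    (hφ : 0 ≤ Real.sin φ * Real.cos φ) (x : II n d K → ℝ) :
    -(ρ * β) * ∑ i, pf' T δ ρ β φ i x ≤
      Real.sin φ * Real.cos φ * ((ρ * β) ^ 2 * K ^ 2) * pF T δ ρ β φ x := by
  set S := Real.sin φ
  set C := Real.cos φ
  have hTs : ∀ t, ∑ l, T t l ^ 2 ≤ 1 := fun t => by simp_rw [pow_two]; exact (hT t).le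
  set ν : Fin K → Fin q → Fin n → ℝ := fun k t j => nn δ (pa T φ x k t) j with hν
  set R : Fin K → Fin q → Fin K → Fin q → ℝ := fun k t k' t' =>
    (∑ j, ν k t j * ν k' t' j) * (∑ l, T t l * T t' l) -
      if k = k' then (∑ j, ν k t j * ν k' t' j) + (∑ l, T t l * T t' l) else 0 with hR
  have key := sum_ff' (δ := δ) (ρ := ρ) (β := β)
    (fun k t j i => cA T C (-S) k t j i)
    (fun k t j i => cA (n := n) (K := K) T S C k t j i) (fun k t i => cB n T (-S) k t i)
    (fun k t i => cB n T C k t i) (fun k t j l => cA_zero T hT S C k t j l) (pa T φ x) (pb T φ x)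
    (fun k t k' t' => S * C * R k t k' t') (fun k t k' t' => by
      rw [cAB_R]
      simp only [hR, hν]
      split_ifs <;> ring)
  have hn : ∀ k t k' t', |∑ j, ν k t j * ν k' t' j| ≤ 1 := fun k t k' t' =>
    abs_dot_le_one _ _ (nn_sq_sum hδ _) (nn_sq_sum hδ _)
  have ht : ∀ t t', |∑ l, T t l * T t' l| ≤ 1 := fun t t' =>
    abs_dot_le_one _ _ (hTs t) (hTs t')
  have hal := alg (K := K) (ε := ρ * β) (β := β) (by positivity) (mul_le_of_le_one_left hβ hρ1)
    (fun k t => ww β (yy δ (pa T φ x) (pb T φ x) k) t)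
    (fun k t => ww_nonneg _ _ _) (fun k => ww_sum _ _) R
    (fun k t => by simp only [hR, if_true, hT]; ring)
    (fun k t t' => by
      simp only [hR, if_true]
      have h1 := abs_le.1 (hn k t k t')
      have h2 := abs_le.1 (ht t t')
      nlinarith [mul_nonneg (sub_nonneg.2 h1.2) (sub_nonneg.2 h2.2)])
    (fun k t k' t' h => by
      simp only [hR, h, if_false, sub_zero]
      refine (le_abs_self _).trans ?_
      rw [abs_mul]
      exact mul_le_one₀ (hn _ _ _ _) (abs_nonneg _) (ht _ _))
  have hG : 0 < pF T δ ρ β φ x := GG_pos _ _ _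
  have e : ∑ i, pf' T δ ρ β φ i x = -(pF T δ ρ β φ x * (S * C * (ρ * β * ∑ k', ∑ t', ∑ k, ∑ t,
        ww β (yy δ (pa T φ x) (pb T φ x) k') t' * ww β (yy δ (pa T φ x) (pb T φ x) k) t * R k' t' k t +
      β * ∑ k, ∑ t, ww β (yy δ (pa T φ x) (pb T φ x) k) t * (R k t k t -
        ∑ t', ww β (yy δ (pa T φ x) (pb T φ x) k) t' * R k t' k t)))) := by
    refine key.trans ?_
    unfold pF
    congr 2
    rw [mul_add]
    congr 1
    · rw [mul_left_comm]
      congr 1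
      simp_rw [Finset.mul_sum]
      refine Finset.sum_congr rfl fun k' _ => Finset.sum_congr rfl fun t' _ =>
        Finset.sum_congr rfl fun k _ => Finset.sum_congr rfl fun t _ => ?_
      ring
    · rw [mul_left_comm]
      congr 1
      rw [Finset.mul_sum]
      refine Finset.sum_congr rfl fun k _ => ?_
      rw [Finset.mul_sum]
      refine Finset.sum_congr rfl fun t _ => ?_
      have : ∑ t', ww β (yy δ (pa T φ x) (pb T φ x) k) t' * (S * C * R k t' k t) =
          S * C * ∑ t', ww β (yy δ (pa T φ x) (pb T φ x) k) t' * R k t' k t := by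
        rw [Finset.mul_sum]
        refine Finset.sum_congr rfl fun t' _ => ?_
        ring
      rw [this]
      ring
  rw [e]
  have h3 := mul_le_mul_of_nonneg_left hal (mul_nonneg hφ hG.le)
  calc _ = _ := by ring
    _ ≤ _ := h3
    _ = _ := by ring

theorem path_ineq [NeZero q] (T : Fin q → Fin d → ℝ) (hT : ∀ t, ∑ l, T t l * T t l = 1)
    {δ ρ β : ℝ} (hδ : 0 < δ) (hρ : 0 ≤ ρ) (hρ1 : ρ ≤ 1) (hβ : 0 ≤ β) :
    ∫ x, pF T δ ρ β (Real.pi / 2) x ∂(gpi (II n d K)) ≤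
      Real.exp ((ρ * β) ^ 2 * K ^ 2 / 2) * ∫ x, pF T δ ρ β 0 x ∂(gpi (II n d K)) := by
  have hTa : ∀ t l, |T t l| ≤ 1 := fun t l => by
    rw [← sq_le_one_iff_abs_le_one, pow_two, ← hT t]
    exact Finset.single_le_sum (f := fun l => T t l * T t l) (fun _ _ => mul_self_nonneg _)
      (Finset.mem_univ l)
  set γ := gpi (II n d K)
  set c0 := Real.exp (ρ * (K * (Real.log q))) with hc0
  have hc0p : 0 < c0 := Real.exp_pos _
  set L := ρ * (K * β) with hL
  have hFb := fun φ (x : II n d K → ℝ) => pF_le (K := K) (n := n) T hTa hδ hρ hβ φ x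
  have hF0 : ∀ φ (x : II n d K → ℝ), 0 < pF T δ ρ β φ x := fun φ x => GG_pos _ _ _
  have hFc : ∀ φ, Continuous (fun x : II n d K → ℝ => pF T δ ρ β φ x) := fun φ =>
    cont_GG (cont_yy (cont_pa T φ) (cont_pb T φ))
  have hFi : ∀ φ, Integrable (fun x => pF T δ ρ β φ x) γ := fun φ =>
    gpi_dom c0 L _ (hFc φ).aestronglyMeasurable (fun x => by
      rw [abs_of_pos (hF0 φ x)]; exact hFb φ x)
  have hns : ∀ φ : ℝ, |-Real.sin φ| ≤ 1 := fun φ => by rw [abs_neg]; exact Real.abs_sin_le_one φ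
  have hfc : ∀ φ i, Continuous (fun x : II n d K → ℝ => pf T δ ρ β φ i x) := fun φ i =>
    cont_ff hδ (cont_pa T φ) (cont_pb T φ)
  have hfb : ∀ φ i (x : II n d K → ℝ), |pf T δ ρ β φ i x| ≤ (K * (n + 1)) * pF T δ ρ β φ x :=
    fun φ i x => bd_ff hδ ρ β _ _
      (fun k t j => cA_abs T hTa (Real.abs_cos_le_one φ) (hns φ) k t j i)
      (fun k t => cB_abs T hTa (hns φ) k t i) _ _
  have hfb2 : ∀ φ i (x : II n d K → ℝ), |pf T δ ρ β φ i x| ≤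
      (K * (n + 1)) * c0 * Real.exp (L * ∑ i, |x i|) := fun φ i x => by
    refine (hfb φ i x).trans ?_
    calc _ ≤ ((K : ℝ) * (n + 1)) * (c0 * Real.exp (L * ∑ i, |x i|)) :=
          mul_le_mul_of_nonneg_left (hFb φ x) (by positivity)
      _ = _ := by ring
  have hfi : ∀ φ i, Integrable (fun x => pf T δ ρ β φ i x) γ := fun φ i =>
    gpi_dom ((K * (n + 1)) * c0) L _ (hfc φ i).aestronglyMeasurable (hfb2 φ i)
  have hxexp : ∀ (x : II n d K → ℝ), ∑ i, |x i| ≤ Real.exp (∑ i, |x i|) := fun x => by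
    have := Real.add_one_le_exp (∑ i, |x i|); linarith
  have hsb : ∀ φ (x : II n d K → ℝ), ∑ i, |x i * pf T δ ρ β φ i x| ≤
      (K * (n + 1)) * c0 * Real.exp ((L + 1) * ∑ i, |x i|) := fun φ x => by
    calc _ ≤ ∑ i, |x i| * ((K * (n + 1)) * c0 * Real.exp (L * ∑ i, |x i|)) := by
          refine Finset.sum_le_sum fun i _ => ?_
          rw [abs_mul]
          exact mul_le_mul_of_nonneg_left (hfb2 φ i x) (abs_nonneg _)
      _ = (∑ i, |x i|) * ((K * (n + 1)) * c0 * Real.exp (L * ∑ i, |x i|)) := by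
          rw [Finset.sum_mul]
      _ ≤ Real.exp (∑ i, |x i|) * ((K * (n + 1)) * c0 * Real.exp (L * ∑ i, |x i|)) :=
          mul_le_mul_of_nonneg_right (hxexp x) (by positivity)
      _ = _ := by rw [add_mul, Real.exp_add, one_mul]; ring
  have hxfi : ∀ φ i, Integrable (fun x => x i * pf T δ ρ β φ i x) γ := fun φ i =>
    gpi_dom ((K * (n + 1)) * c0) (L + 1) _
      (((continuous_apply i).mul (hfc φ i)).aestronglyMeasurable) (fun x =>
        (Finset.single_le_sum (f := fun i => |x i * pf T δ ρ β φ i x|)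
          (fun _ _ => abs_nonneg _) (Finset.mem_univ i)).trans (hsb φ x))
  obtain ⟨c1, hc1⟩ := bd_ff' (K := K) (q := q) (n := n) hδ ρ β
  have hf'i : ∀ φ i, Integrable (fun x => pf' T δ ρ β φ i x) γ := fun φ i => by
    refine gpi_dom (|c1| * c0) L _ (cont_ff' hδ (cont_pa T φ) (cont_pb T φ)).aestronglyMeasurable
      (fun x => ?_)
    refine (hc1 _ _ (fun k t j => cA_abs T hTa (Real.abs_cos_le_one φ) (hns φ) k t j i)
      (fun k t => cB_abs T hTa (hns φ) k t i) _ _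
      (fun k t j => cA_abs T hTa (Real.abs_sin_le_one φ) (Real.abs_cos_le_one φ) k t j i)
      (fun k t => cB_abs T hTa (Real.abs_cos_le_one φ) k t i) _ _).trans ?_
    rw [mul_assoc]
    exact mul_le_mul (le_abs_self _) (hFb φ x) (hF0 φ x).le (abs_nonneg _)
  have hder : ∀ φ, HasDerivAt (fun s => ∫ x, pF T δ ρ β s x ∂γ)
      (∫ x, -(ρ * β) * ∑ i, x i * pf T δ ρ β φ i x ∂γ) φ := by
    intro φ
    refine (hasDerivAt_integral_of_dominated_loc_of_deriv_le (s := Set.univ)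
      (F := fun s (x : II n d K → ℝ) => pF T δ ρ β s x)
      (F' := fun s (x : II n d K → ℝ) => -(ρ * β) * ∑ i, x i * pf T δ ρ β s i x)
      (bound := fun x => |ρ * β| * ((K * (n + 1)) * c0 * Real.exp ((L + 1) * ∑ i, |x i|)))
      Filter.univ_mem
      (Filter.Eventually.of_forall fun s => (hFc s).aestronglyMeasurable) (hFi φ) ?_ ?_ ?_ ?_).2
    · have := hfc φ
      exact Continuous.aestronglyMeasurable (by fun_prop)
    · refine Filter.Eventually.of_forall fun x s _ => ?_
      rw [Real.norm_eq_abs, abs_mul, abs_neg]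
      exact mul_le_mul_of_nonneg_left ((Finset.abs_sum_le_sum_abs _ _).trans (hsb s x))
        (abs_nonneg _)
    · exact ((gpi_exp (L + 1)).const_mul _).const_mul _
    · exact Filter.Eventually.of_forall fun x s _ => pF_deriv T hδ s x
  have hval : ∀ φ, 0 ≤ Real.sin φ * Real.cos φ →
      ∫ x, -(ρ * β) * ∑ i, x i * pf T δ ρ β φ i x ∂γ ≤
        Real.sin φ * Real.cos φ * ((ρ * β) ^ 2 * K ^ 2) * ∫ x, pF T δ ρ β φ x ∂γ := by
    intro φ hφ
    have e : ∫ x, -(ρ * β) * ∑ i, x i * pf T δ ρ β φ i x ∂γ =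
        ∫ x, -(ρ * β) * ∑ i, pf' T δ ρ β φ i x ∂γ := by
      rw [integral_const_mul, integral_const_mul, integral_finsetSum _ (fun i _ => hxfi φ i),
        integral_finsetSum _ (fun i _ => hf'i φ i)]
      congr 1
      refine Finset.sum_congr rfl fun i _ => ?_
      exact gpi_ibp i _ _ (fun x => pf_deriv T hδ φ i x) (hfi φ i) (hxfi φ i) (hf'i φ i)
    rw [e, ← integral_const_mul]
    refine integral_mono ((integrable_finsetSum _ (fun i _ => hf'i φ i)).const_mul _)
      ((hFi φ).const_mul _) (fun x => ?_)
    exact pf'_sum T hT hδ hρ hρ1 hβ hφ x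
  set M := (ρ * β) ^ 2 * (K : ℝ) ^ 2 with hM
  have hder2 : ∀ φ, HasDerivAt (fun s => (∫ x, pF T δ ρ β s x ∂γ) * Real.exp (-(M / 2 * Real.sin s ^ 2)))
      ((∫ x, -(ρ * β) * ∑ i, x i * pf T δ ρ β φ i x ∂γ) * Real.exp (-(M / 2 * Real.sin φ ^ 2)) +
       (∫ x, pF T δ ρ β φ x ∂γ) * (Real.exp (-(M / 2 * Real.sin φ ^ 2)) *
        (-(M * (Real.sin φ * Real.cos φ))))) φ := by
    intro φ
    refine (hder φ).fun_mul ?_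
    refine HasDerivAt.exp ?_
    refine ((((Real.hasDerivAt_sin φ).fun_pow 2).const_mul (M / 2)).neg).congr_deriv ?_
    simp
    ring
  have hanti : AntitoneOn (fun s => (∫ x, pF T δ ρ β s x ∂γ) *
      Real.exp (-(M / 2 * Real.sin s ^ 2))) (Set.Icc 0 (Real.pi / 2)) := by
    refine antitoneOn_of_deriv_nonpos (convex_Icc _ _)
      (fun φ _ => (hder2 φ).continuousAt.continuousWithinAt)
      (fun φ _ => (hder2 φ).differentiableAt.differentiableWithinAt) ?_
    intro φ hφ
    rw [interior_Icc] at hφ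
    rw [(hder2 φ).deriv]
    have h1 : 0 ≤ Real.sin φ * Real.cos φ := mul_nonneg
      (Real.sin_nonneg_of_nonneg_of_le_pi hφ.1.le (by linarith [hφ.2, Real.pi_pos]))
      (Real.cos_nonneg_of_mem_Icc ⟨by linarith [hφ.1, Real.pi_pos], hφ.2.le⟩)
    have h2 := mul_le_mul_of_nonneg_right (hval φ h1) (Real.exp_pos (-(M / 2 * Real.sin φ ^ 2))).le
    linarith
  have hpi := Real.pi_pos
  have := hanti (Set.left_mem_Icc.2 (by positivity)) (Set.right_mem_Icc.2 (by positivity))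
    (by positivity)
  simp only [Real.sin_pi_div_two, Real.sin_zero] at this
  norm_num at this
  rw [Real.exp_neg] at this
  rw [mul_inv_le_iff₀ (Real.exp_pos _)] at this
  linarith

end path

section fin
variable {K q n d : ℕ}

/-- the comparison variable -/
noncomputable def ZZ (w : (Fin d → ℝ) → ℝ) (z : Fin n ⊕ Fin d → ℝ) : ℝ :=
  euclNorm (fun j => z (Sum.inl j)) - w (fun l => z (Sum.inr l))

lemma euclNorm_nonneg (v : Fin n → ℝ) : 0 ≤ euclNorm v := Real.sqrt_nonneg _

lemma cont_euclNorm : Continuous (fun v : Fin n → ℝ => euclNorm v) := by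
  unfold euclNorm
  fun_prop

lemma euclNorm_le_sum (v : Fin n → ℝ) : euclNorm v ≤ ∑ j, |v j| := by
  unfold euclNorm
  refine Real.sqrt_le_iff.2 ⟨Finset.sum_nonneg fun _ _ => abs_nonneg _, ?_⟩
  have := Finset.sum_sq_le_sq_sum_of_nonneg (s := Finset.univ) (f := fun j => |v j|)
    (fun _ _ => abs_nonneg _)
  simpa using this

lemma pa_eq (T : Fin q → Fin d → ℝ) (φ : ℝ) (x : II n d K → ℝ) (k : Fin K) (t : Fin q)
    (j : Fin n) : pa T φ x k t j = Real.sin φ * (∑ l, T t l * x (.inl (j, l))) +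
      Real.cos φ * x (.inr (k, .inl j)) := by
  unfold pa
  rw [Fintype.sum_sum_type, Fintype.sum_prod_type, Fintype.sum_prod_type]
  simp [Fintype.sum_sum_type, cA, ite_mul, Finset.sum_ite_irrel, Finset.mul_sum, mul_assoc]

lemma pb_eq (T : Fin q → Fin d → ℝ) (φ : ℝ) (x : II n d K → ℝ) (k : Fin K) (t : Fin q) :
    pb T φ x k t = -(Real.cos φ * (∑ l, T t l * x (.inr (k, .inr l)))) := by
  unfold pb
  rw [Fintype.sum_sum_type, Fintype.sum_prod_type, Fintype.sum_prod_type]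
  simp [Fintype.sum_sum_type, cB, ite_mul, Finset.sum_ite_irrel, Finset.mul_sum, mul_assoc]

lemma sN_le_add {δ : ℝ} (hδ : 0 < δ) (a : Fin n → ℝ) : sN δ a ≤ euclNorm a + δ := by
  have h := euclNorm_nonneg a
  unfold sN
  refine Real.sqrt_le_iff.2 ⟨by positivity, ?_⟩
  have : euclNorm a ^ 2 = ∑ j, a j ^ 2 := Real.sq_sqrt (Finset.sum_nonneg fun _ _ => sq_nonneg _)
  nlinarith [mul_nonneg h hδ.le]

lemma sN_ge_norm (δ : ℝ) (a : Fin n → ℝ) : euclNorm a ≤ sN δ a := by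
  unfold sN euclNorm
  exact Real.sqrt_le_sqrt (by nlinarith [sq_nonneg δ])

lemma pF_end [NeZero q] (T : Fin q → Fin d → ℝ) {δ ρ β : ℝ} (hδ : 0 < δ) (hρ : 0 ≤ ρ)
    (hβ : 0 ≤ β) (x : II n d K → ℝ) (t : Fin q) :
    Real.exp (-(ρ * K * β) * (euclNorm (fun j => ∑ l, T t l * x (.inl (j, l))) + δ)) ≤
      pF T δ ρ β (Real.pi / 2) x := by
  unfold pF GG
  rw [Real.exp_le_exp]
  set m := euclNorm (fun j => ∑ l, T t l * x (.inl (j, l))) with hm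
  have h : ∀ k : Fin K, -β * (m + δ) ≤
      Real.log (sm β (yy δ (pa T (Real.pi / 2) x) (pb T (Real.pi / 2) x) k)) := by
    intro k
    rw [Real.le_log_iff_exp_le (sm_pos _ _)]
    refine le_trans ?_ (Finset.single_le_sum
      (f := fun t => Real.exp (-β * yy δ (pa T (Real.pi / 2) x) (pb T (Real.pi / 2) x) k t))
      (fun _ _ => (Real.exp_pos _).le) (Finset.mem_univ t))
    rw [Real.exp_le_exp]
    have h1 : yy δ (pa T (Real.pi / 2) x) (pb T (Real.pi / 2) x) k t ≤ m + δ := by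
      unfold yy
      rw [pb_eq]
      have : pa T (Real.pi / 2) x k t = fun j => ∑ l, T t l * x (.inl (j, l)) := by
        funext j; rw [pa_eq]; simp
      rw [this]
      have := sN_le_add hδ (fun j => ∑ l, T t l * x (.inl (j, l)))
      simpa using this
    nlinarith
  calc _ = ρ * ∑ k : Fin K, (-β * (m + δ)) := by simp; ring
    _ ≤ _ := mul_le_mul_of_nonneg_left (Finset.sum_le_sum fun k _ => h k) hρ

lemma pF_start [NeZero q] (T : Fin q → Fin d → ℝ) (w : (Fin d → ℝ) → ℝ)
    (hw : ∀ t h, ∑ l, T t l * h l ≤ w h) {δ ρ β : ℝ} (hρ : 0 ≤ ρ)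
    (hβ : 0 ≤ β) (x : II n d K → ℝ) :
    pF T δ ρ β 0 x ≤ Real.exp (ρ * K * Real.log q) *
      ∏ k : Fin K, Real.exp (-(ρ * β) * ZZ w (fun i => x (.inr (k, i)))) := by
  have hq : (0 : ℝ) < q := by exact_mod_cast Nat.pos_of_ne_zero (NeZero.ne q)
  rw [← Real.exp_sum, ← Real.exp_add]
  unfold pF GG
  rw [Real.exp_le_exp]
  have h : ∀ k : Fin K, Real.log (sm β (yy δ (pa T 0 x) (pb T 0 x) k)) ≤
      Real.log q + -β * ZZ w (fun i => x (.inr (k, i))) := by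
    intro k
    rw [Real.log_le_iff_le_exp (sm_pos _ _), Real.exp_add, Real.exp_log hq]
    calc _ ≤ ∑ t : Fin q, Real.exp (-β * ZZ w (fun i => x (.inr (k, i)))) := by
          refine Finset.sum_le_sum fun t _ => ?_
          rw [Real.exp_le_exp]
          have h1 : ZZ w (fun i => x (.inr (k, i))) ≤ yy δ (pa T 0 x) (pb T 0 x) k t := by
            unfold yy ZZ
            rw [pb_eq]
            have : pa T 0 x k t = fun j => x (.inr (k, .inl j)) := by
              funext j; rw [pa_eq]; simp
            rw [this]
            have h1 := sN_ge_norm δ (fun j => x (.inr (k, .inl j)))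
            have h2 := hw t (fun l => x (.inr (k, .inr l)))
            simp only [Real.cos_zero, one_mul]
            linarith
          nlinarith
      _ = _ := by simp
  calc _ ≤ ρ * ∑ k : Fin K, (Real.log q + -β * ZZ w (fun i => x (.inr (k, i)))) :=
        mul_le_mul_of_nonneg_left (Finset.sum_le_sum fun k _ => h k) hρ
    _ = _ := by
        rw [Finset.sum_add_distrib, mul_add, Finset.mul_sum Finset.univ (fun k => -β * ZZ w (fun i => x (.inr (k, i)))) ρ]
        simp only [Finset.sum_const, Finset.card_univ, Fintype.card_fin, nsmul_eq_mul]
        congr 1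
        · ring
        · exact Finset.sum_congr rfl fun k _ => by ring

lemma cont_ZZ {w : (Fin d → ℝ) → ℝ} (hwc : Continuous w) :
    Continuous (fun z : Fin n ⊕ Fin d → ℝ => ZZ w z) := by
  unfold ZZ
  exact (cont_euclNorm.comp (by fun_prop)).sub (hwc.comp (by fun_prop))

lemma ZZ_abs {w : (Fin d → ℝ) → ℝ} (hwb : ∀ h, |w h| ≤ ∑ l, |h l|) (z : Fin n ⊕ Fin d → ℝ) :
    |ZZ w z| ≤ ∑ i, |z i| := by
  rw [Fintype.sum_sum_type]
  unfold ZZ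
  refine (abs_sub _ _).trans (add_le_add ?_ (hwb _))
  rw [abs_of_nonneg (euclNorm_nonneg _)]
  exact euclNorm_le_sum _

lemma int_replica (f : (Fin n ⊕ Fin d → ℝ) → ℝ) (hf : Continuous f) :
    ∫ x, ∏ k : Fin K, f (fun i => x (.inr (k, i))) ∂(gpi (II n d K)) =
      (∫ z, f z ∂(gpi (Fin n ⊕ Fin d))) ^ K := by
  have h1 := gpi_comp_inj (ι := II n d K) (κ := Fin K × (Fin n ⊕ Fin d)) Sum.inr Sum.inr_injective
  have h2 := (gpi_curry (Fin K) (Fin n ⊕ Fin d)).comp h1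
  have h3 : ∫ x, ∏ k : Fin K, f (x k) ∂(Measure.pi fun _ : Fin K => gpi (Fin n ⊕ Fin d)) =
      (∫ z, f z ∂(gpi (Fin n ⊕ Fin d))) ^ K := by
    rw [integral_fintype_prod_eq_pow, Fintype.card_fin]
  rw [← h3, ← h2.map_eq, integral_map h2.measurable.aemeasurable]
  · rfl
  · exact Continuous.aestronglyMeasurable (by fun_prop)

lemma ZZ_exp_int {w : (Fin d → ℝ) → ℝ} (hwc : Continuous w) (hwb : ∀ h, |w h| ≤ ∑ l, |h l|)
    (s : ℝ) : Integrable (fun z : Fin n ⊕ Fin d → ℝ => Real.exp (s * ZZ w z)) (gpi _) := by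
  have := cont_ZZ (n := n) hwc
  refine gpi_dom 1 |s| _ (Continuous.aestronglyMeasurable (by fun_prop)) fun z => ?_
  rw [Real.abs_exp, one_mul, Real.exp_le_exp]
  refine (le_abs_self _).trans ?_
  rw [abs_mul]
  exact mul_le_mul_of_nonneg_left (ZZ_abs hwb z) (abs_nonneg _)

lemma fin_step1 [NeZero q] (T : Fin q → Fin d → ℝ) (hT : ∀ t, ∑ l, T t l * T t l = 1)
    (w : (Fin d → ℝ) → ℝ) (hwc : Continuous w) (hwb : ∀ h, |w h| ≤ ∑ l, |h l|)
    (hw : ∀ t h, ∑ l, T t l * h l ≤ w h) {lam c δ β : ℝ} (hl : 0 < lam) (hδ : 0 < δ)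
    (hK : 0 < K) (hβ : lam ≤ K * β) :
    (gpi (Fin n × Fin d)).real {X | ∃ t, euclNorm (fun j => ∑ l, T t l * X (j, l)) < c} ≤
      Real.exp (lam * (c + δ)) * (Real.exp (lam ^ 2 / 2) * (Real.exp (lam / β * Real.log q) *
        (∫ z, Real.exp (-(lam / K) * ZZ w z) ∂(gpi (Fin n ⊕ Fin d))) ^ K)) := by
  have hK0 : (0 : ℝ) < K := by exact_mod_cast hK
  have hβ0 : 0 < β := by
    by_contra h
    have : K * β ≤ 0 := mul_nonpos_of_nonneg_of_nonpos hK0.le (not_lt.1 h)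
    linarith
  set ρ := lam / (K * β) with hρd
  have hρ : 0 ≤ ρ := by positivity
  have hρ1 : ρ ≤ 1 := by rw [hρd, div_le_one (by positivity)]; exact hβ
  have e1 : ρ * K * β = lam := by rw [hρd]; field_simp
  have e2 : ρ * β = lam / K := by rw [hρd]; field_simp
  have e3 : ρ * K = lam / β := by rw [hρd]; field_simp
  have hTa : ∀ t l, |T t l| ≤ 1 := fun t l => by
    rw [← sq_le_one_iff_abs_le_one, pow_two, ← hT t]
    exact Finset.single_le_sum (f := fun l => T t l * T t l) (fun _ _ => mul_self_nonneg _)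
      (Finset.mem_univ l)
  have hFc : ∀ φ, Continuous (fun x : II n d K → ℝ => pF T δ ρ β φ x) := fun φ =>
    cont_GG (cont_yy (cont_pa T φ) (cont_pb T φ))
  have hF0 : ∀ φ (x : II n d K → ℝ), 0 < pF T δ ρ β φ x := fun φ x => GG_pos _ _ _
  have hFi : ∀ φ, Integrable (fun x => pF T δ ρ β φ x) (gpi (II n d K)) := fun φ =>
    gpi_dom _ _ _ (hFc φ).aestronglyMeasurable (fun x => by
      rw [abs_of_pos (hF0 φ x)]; exact pF_le T hTa hδ hρ hβ0.le φ x)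
  set A : Set (Fin n × Fin d → ℝ) := {X | ∃ t, euclNorm (fun j => ∑ l, T t l * X (j, l)) < c}
    with hA
  have hAo : IsOpen A := by
    rw [hA, Set.ofPred_exists]
    refine isOpen_iUnion fun t => isOpen_lt (cont_euclNorm.comp (by fun_prop)) continuous_const
  have hmp := gpi_comp_inj (ι := II n d K) (κ := Fin n × Fin d) Sum.inl Sum.inl_injective
  set A' : Set (II n d K → ℝ) := (fun x j => x (Sum.inl j)) ⁻¹' A with hA'
  have hA'm : MeasurableSet A' := hmp.measurable hAo.measurableSet
  have hPA : (gpi (Fin n × Fin d)).real A = (gpi (II n d K)).real A' := by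
    rw [measureReal_def, measureReal_def, hmp.measure_preimage hAo.measurableSet.nullMeasurableSet]
  have lower : (gpi (II n d K)).real A' * Real.exp (-(lam * (c + δ))) ≤
      ∫ x, pF T δ ρ β (Real.pi / 2) x ∂(gpi (II n d K)) := by
    calc _ = ∫ x, A'.indicator (fun _ => Real.exp (-(lam * (c + δ)))) x ∂(gpi (II n d K)) := by
          rw [integral_indicator_const _ hA'm, smul_eq_mul]
      _ ≤ _ := by
          refine integral_mono ((integrable_const _).indicator hA'm) (hFi _) fun x => ?_
          by_cases hx : x ∈ A'
          · rw [Set.indicator_of_mem hx]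
            obtain ⟨t, ht⟩ := hx
            refine le_trans ?_ (pF_end T hδ hρ hβ0.le x t)
            rw [Real.exp_le_exp, e1]
            simp only at ht
            nlinarith
          · rw [Set.indicator_of_notMem hx]
            exact (hF0 _ x).le
  have upper : ∫ x, pF T δ ρ β 0 x ∂(gpi (II n d K)) ≤ Real.exp (lam / β * Real.log q) *
        (∫ z, Real.exp (-(lam / K) * ZZ w z) ∂(gpi (Fin n ⊕ Fin d))) ^ K := by
    have hc : Continuous (fun z : Fin n ⊕ Fin d → ℝ => Real.exp (-(lam / K) * ZZ w z)) := by
      have := cont_ZZ (n := n) hwc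
      fun_prop
    rw [← int_replica _ hc, ← integral_const_mul]
    refine integral_mono (hFi _) (Integrable.const_mul ?_ _) fun x => ?_
    · have hcc := cont_ZZ (n := n) hwc
      refine gpi_dom 1 (lam / K) _ (Continuous.aestronglyMeasurable (by fun_prop)) fun x => ?_
      rw [← Real.exp_sum, Real.abs_exp, one_mul, Real.exp_le_exp, ← Finset.mul_sum, neg_mul,
        ← mul_neg]
      refine mul_le_mul_of_nonneg_left ?_ (by positivity)
      refine (neg_le_abs _).trans ((Finset.abs_sum_le_sum_abs _ _).trans ?_)
      rw [Fintype.sum_sum_type, Fintype.sum_prod_type (f := fun i : Fin K × (Fin n ⊕ Fin d) => |x (Sum.inr i)|)]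
      refine le_add_of_nonneg_of_le (Finset.sum_nonneg fun _ _ => abs_nonneg _) ?_
      exact Finset.sum_le_sum fun k _ => ZZ_abs hwb _
    · have := pF_start T w hw (δ := δ) hρ hβ0.le x
      rw [e2, e3] at this
      exact this
  have path := path_ineq (n := n) (K := K) T hT hδ hρ hρ1 hβ0.le
  have e4 : (ρ * β) ^ 2 * K ^ 2 / 2 = lam ^ 2 / 2 := by rw [← e1]; ring
  rw [e4] at path
  rw [hPA]
  have h5 : (gpi (II n d K)).real A' * Real.exp (-(lam * (c + δ))) ≤ Real.exp (lam ^ 2 / 2) * (Real.exp (lam / β * Real.log q) *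
        (∫ z, Real.exp (-(lam / K) * ZZ w z) ∂(gpi (Fin n ⊕ Fin d))) ^ K) :=
    lower.trans (path.trans (mul_le_mul_of_nonneg_left upper (Real.exp_pos _).le))
  rw [Real.exp_neg, mul_inv_le_iff₀ (Real.exp_pos _)] at h5
  linarith

lemma exp_quad (y : ℝ) : Real.exp y ≤ 1 + y + y ^ 2 * Real.exp |y| := by
  have h0 : ∀ s : ℝ, 0 ≤ s → Real.exp s ≤ 1 + s + s ^ 2 * Real.exp s := by
    intro s hs
    have h1 : Real.exp s * (1 - s) ≤ 1 := by
      have := Real.add_one_le_exp (-s)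
      calc Real.exp s * (1 - s) ≤ Real.exp s * Real.exp (-s) :=
            mul_le_mul_of_nonneg_left (by linarith) (Real.exp_pos _).le
        _ = 1 := by rw [← Real.exp_add]; simp
    nlinarith
  rcases le_total 0 y with h | h
  · rw [abs_of_nonneg h]; exact h0 y h
  · rw [abs_of_nonpos h]
    have h1 := Real.add_one_le_exp (-y)
    have h2 : Real.exp y * (1 - y) ≤ 1 := by
      calc Real.exp y * (1 - y) ≤ Real.exp y * Real.exp (-y) :=
            mul_le_mul_of_nonneg_left (by linarith) (Real.exp_pos _).le
        _ = 1 := by rw [← Real.exp_add]; simp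
    have h3 : Real.exp y ≤ 1 + y + y ^ 2 := by
      have : 0 < 1 - y := by linarith
      refine le_of_mul_le_mul_right ?_ this
      nlinarith [pow_nonneg (neg_nonneg.2 h) 3]
    have h4 : 1 ≤ Real.exp (-y) := by linarith
    nlinarith [sq_nonneg y]

lemma fin_escape [NeZero q] (T : Fin q → Fin d → ℝ) (hT : ∀ t, ∑ l, T t l * T t l = 1)
    (w : (Fin d → ℝ) → ℝ) (hwc : Continuous w) (hwb : ∀ h, |w h| ≤ ∑ l, |h l|)
    (hw : ∀ t h, ∑ l, T t l * h l ≤ w h) {lam c : ℝ} (hl : 0 < lam) :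
    (gpi (Fin n × Fin d)).real {X | ∃ t, euclNorm (fun j => ∑ l, T t l * X (j, l)) < c} ≤
      Real.exp (lam * c + lam ^ 2 / 2 - lam * ∫ z, ZZ w z ∂(gpi (Fin n ⊕ Fin d))) := by
  set P := (gpi (Fin n × Fin d)).real {X | ∃ t, euclNorm (fun j => ∑ l, T t l * X (j, l)) < c}
  have hcc := cont_ZZ (n := n) hwc
  have hZi : Integrable (fun z : Fin n ⊕ Fin d → ℝ => ZZ w z) (gpi _) := by
    refine gpi_dom 1 1 _ hcc.aestronglyMeasurable fun z => ?_
    refine (ZZ_abs hwb z).trans ?_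
    have := Real.add_one_le_exp (∑ i, |z i|)
    simp only [one_mul]; linarith
  have hMi : Integrable (fun z : Fin n ⊕ Fin d → ℝ => ZZ w z ^ 2 * Real.exp (lam * |ZZ w z|))
      (gpi _) := by
    refine gpi_dom 1 (2 + lam) _ (Continuous.aestronglyMeasurable (by fun_prop)) fun z => ?_
    have h0 := ZZ_abs hwb z
    have h1 := Real.add_one_le_exp (∑ i, |z i|)
    rw [abs_mul, Real.abs_exp, one_mul, add_mul, Real.exp_add, abs_pow]
    refine mul_le_mul ?_ ?_ (Real.exp_pos _).le (Real.exp_pos _).le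
    · have : Real.exp (2 * ∑ i, |z i|) = Real.exp (∑ i, |z i|) ^ 2 := by
        rw [← Real.exp_nat_mul]; simp
      rw [this]
      exact pow_le_pow_left₀ (abs_nonneg _) (by linarith) 2
    · rw [Real.exp_le_exp]
      exact mul_le_mul_of_nonneg_left h0 hl.le
  set EZ := ∫ z, ZZ w z ∂(gpi (Fin n ⊕ Fin d))
  set M := ∫ z, ZZ w z ^ 2 * Real.exp (lam * |ZZ w z|) ∂(gpi (Fin n ⊕ Fin d))
  have hI : ∀ K : ℕ, 0 < K → (∫ z, Real.exp (-(lam / K) * ZZ w z) ∂(gpi (Fin n ⊕ Fin d))) ^ K ≤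
      Real.exp (-lam * EZ + lam ^ 2 * M / K) := by
    intro K hK
    have hK0 : (0 : ℝ) < K := by exact_mod_cast hK
    have hK1 : (1 : ℝ) ≤ K := by exact_mod_cast hK
    have h1 : ∫ z, Real.exp (-(lam / K) * ZZ w z) ∂(gpi (Fin n ⊕ Fin d)) ≤
        1 + -(lam / K) * EZ + (lam / K) ^ 2 * M := by
      have e : 1 + -(lam / K) * EZ + (lam / K) ^ 2 * M = ∫ z, (1 + -(lam / K) * ZZ w z +
          (lam / K) ^ 2 * (ZZ w z ^ 2 * Real.exp (lam * |ZZ w z|))) ∂(gpi (Fin n ⊕ Fin d)) := by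
        have i1 : Integrable (fun z : Fin n ⊕ Fin d → ℝ => 1 + -(lam / K) * ZZ w z)
          (gpi (Fin n ⊕ Fin d)) := (integrable_const _).add (hZi.const_mul _)
        rw [integral_add i1 (hMi.const_mul _),
          integral_add (integrable_const _) (hZi.const_mul _), integral_const_mul,
          integral_const_mul]
        simp [EZ, M]
      rw [e]
      refine integral_mono (ZZ_exp_int hwc hwb _)
        (((integrable_const _).add (hZi.const_mul _)).add (hMi.const_mul _)) fun z => ?_
      refine (exp_quad _).trans ?_
      have h2 : |-(lam / K) * ZZ w z| ≤ lam * |ZZ w z| := by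
        rw [abs_mul, abs_neg, abs_of_pos (by positivity)]
        exact mul_le_mul_of_nonneg_right (div_le_self hl.le hK1) (abs_nonneg _)
      have h3 := mul_le_mul_of_nonneg_left (Real.exp_le_exp.2 h2)
        (sq_nonneg (-(lam / K) * ZZ w z))
      calc _ ≤ 1 + -(lam / K) * ZZ w z + (-(lam / K) * ZZ w z) ^ 2 * Real.exp (lam * |ZZ w z|) :=
            by linarith
        _ = _ := by ring
    have h2 : 1 + -(lam / K) * EZ + (lam / K) ^ 2 * M ≤
        Real.exp (-(lam / K) * EZ + (lam / K) ^ 2 * M) := by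
      have := Real.add_one_le_exp (-(lam / K) * EZ + (lam / K) ^ 2 * M)
      linarith
    calc _ ≤ Real.exp (-(lam / K) * EZ + (lam / K) ^ 2 * M) ^ K :=
          pow_le_pow_left₀ (integral_nonneg fun _ => (Real.exp_pos _).le) (h1.trans h2) K
      _ = _ := by
          rw [← Real.exp_nat_mul]
          congr 1
          field_simp
  have hP : ∀ K : ℕ, 0 < K → P ≤ Real.exp (lam * c) * (Real.exp (lam ^ 2 / 2) *
      Real.exp (-lam * EZ + lam ^ 2 * M / K)) := by
    intro K hK
    have hK0 : (0 : ℝ) < K := by exact_mod_cast hK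
    have h1 : ∀ᶠ β : ℝ in Filter.atTop, P ≤ Real.exp (lam * (c + β⁻¹)) * (Real.exp (lam ^ 2 / 2) *
        (Real.exp (lam * β⁻¹ * Real.log q) *
        Real.exp (-lam * EZ + lam ^ 2 * M / K))) := by
      filter_upwards [Filter.eventually_ge_atTop (lam / K), Filter.eventually_gt_atTop 0]
        with β hβ hβ0
      refine (fin_step1 (K := K) T hT w hwc hwb hw hl (inv_pos.2 hβ0) hK
        ((div_le_iff₀' hK0).1 hβ)).trans ?_
      rw [div_eq_mul_inv lam β]
      gcongr
      exact hI K hK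
    refine ge_of_tendsto ?_ h1
    have hi : Filter.Tendsto (fun β : ℝ => β⁻¹) Filter.atTop (nhds 0) := tendsto_inv_atTop_zero
    have hf : Continuous (fun s : ℝ => Real.exp (lam * (c + s)) * (Real.exp (lam ^ 2 / 2) *
        (Real.exp (lam * s * Real.log q) *
        Real.exp (-lam * EZ + lam ^ 2 * M / K)))) := by fun_prop
    have := (hf.tendsto 0).comp hi
    simpa [Function.comp_def] using this
  have hi : Filter.Tendsto (fun K : ℕ => ((K : ℝ))⁻¹) Filter.atTop (nhds 0) :=
    tendsto_inv_atTop_nhds_zero_nat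
  have hf : Continuous (fun s : ℝ => Real.exp (lam * c) * (Real.exp (lam ^ 2 / 2) *
      Real.exp (-lam * EZ + lam ^ 2 * M * s))) := by fun_prop
  have hlim := (hf.tendsto 0).comp hi
  have hfin := ge_of_tendsto hlim (by
    filter_upwards [Filter.eventually_gt_atTop 0] with K hK
    have := hP K hK
    rw [div_eq_mul_inv] at this
    exact this)
  refine hfin.trans_eq ?_
  rw [← Real.exp_add, ← Real.exp_add]
  congr 1
  ring

end fin

section final
variable {n d : ℕ}

lemma dot_abs_le {t : Fin d → ℝ} (ht : euclNorm t = 1) (h : Fin d → ℝ) :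
    |dot t h| ≤ ∑ l, |h l| := by
  have h1 : ∑ l, t l ^ 2 = 1 := by
    have := Real.sq_sqrt (Finset.sum_nonneg fun (l : Fin d) (_ : l ∈ Finset.univ) => sq_nonneg (t l))
    unfold euclNorm at ht
    rw [ht] at this
    linarith
  have h2 : ∀ l, |t l| ≤ 1 := fun l => by
    rw [← sq_le_one_iff_abs_le_one, ← h1]
    exact Finset.single_le_sum (f := fun l => t l ^ 2) (fun _ _ => sq_nonneg _)
      (Finset.mem_univ l)
  unfold dot
  refine (Finset.abs_sum_le_sum_abs _ _).trans (Finset.sum_le_sum fun l _ => ?_)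
  rw [abs_mul]
  exact mul_le_of_le_one_left (abs_nonneg _) (h2 l)

lemma set_escape (T : Set (Fin d → ℝ)) (hT : ∀ t ∈ T, euclNorm t = 1) {θ : ℝ} (hθ : 0 < θ) {c : ℝ}
    (hc : c = ∫ g, euclNorm g ∂(stdGaussian n) -
      ∫ h, sSup {r : ℝ | ∃ t ∈ T, r = dot t h} ∂(stdGaussian d) - θ) :
    gpi (Fin n × Fin d) {X | ∃ t ∈ T, euclNorm (fun j => ∑ l, t l * X (j, l)) < c} ≤
      ENNReal.ofReal (Real.exp (-θ ^ 2 / 2)) := by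
  rcases T.eq_empty_or_nonempty with h0 | hne
  · simp [h0]
  set w : (Fin d → ℝ) → ℝ := fun h => sSup {r : ℝ | ∃ t ∈ T, r = dot t h} with hwdef
  have hbdd : ∀ h, BddAbove {r : ℝ | ∃ t ∈ T, r = dot t h} := fun h => by
    refine ⟨∑ l, |h l|, ?_⟩
    rintro r ⟨t, ht, rfl⟩
    exact (le_abs_self _).trans (dot_abs_le (hT t ht) h)
  have hnes : ∀ h, {r : ℝ | ∃ t ∈ T, r = dot t h}.Nonempty := fun h => by
    obtain ⟨t, ht⟩ := hne
    exact ⟨_, t, ht, rfl⟩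
  have hw : ∀ t ∈ T, ∀ h, dot t h ≤ w h := fun t ht h => le_csSup (hbdd h) ⟨t, ht, rfl⟩
  have hwb : ∀ h, |w h| ≤ ∑ l, |h l| := fun h => by
    refine abs_le.2 ⟨?_, ?_⟩
    · obtain ⟨t, ht⟩ := hne
      exact (abs_le.1 (dot_abs_le (hT t ht) h)).1.trans (hw t ht h)
    · refine csSup_le (hnes h) ?_
      rintro r ⟨t, ht, rfl⟩
      exact (le_abs_self _).trans (dot_abs_le (hT t ht) h)
  have hwc : Continuous w := by
    refine (LipschitzWith.of_le_add_mul (d : NNReal) fun h h' => ?_).continuous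
    refine csSup_le (hnes h) ?_
    rintro r ⟨t, ht, rfl⟩
    have e : dot t h = dot t h' + dot t (h - h') := by
      unfold dot
      rw [← Finset.sum_add_distrib]
      exact Finset.sum_congr rfl fun l _ => by simp; ring
    rw [e]
    refine add_le_add (hw t ht h') ((le_abs_self _).trans ((dot_abs_le (hT t ht) _).trans ?_))
    calc _ ≤ ∑ l : Fin d, dist h h' := Finset.sum_le_sum fun l _ => by
          rw [Pi.sub_apply, ← Real.dist_eq]; exact dist_le_pi_dist h h' l
      _ = _ := by simp
  have hlin : ∀ m (x : Fin m → ℝ), ∑ i, |x i| ≤ 1 * Real.exp (1 * ∑ i, |x i|) := fun m x => by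
    have := Real.add_one_le_exp (∑ i, |x i|)
    simp only [one_mul]; linarith
  have hEZ : ∫ z, ZZ w z ∂(gpi (Fin n ⊕ Fin d)) = c + θ := by
    have m1 := gpi_comp_inj (ι := Fin n ⊕ Fin d) (κ := Fin n) Sum.inl Sum.inl_injective
    have m2 := gpi_comp_inj (ι := Fin n ⊕ Fin d) (κ := Fin d) Sum.inr Sum.inr_injective
    have i1 : Integrable (fun g : Fin n → ℝ => euclNorm g) (gpi (Fin n)) :=
      gpi_dom 1 1 _ cont_euclNorm.aestronglyMeasurable fun x => by
        rw [abs_of_nonneg (euclNorm_nonneg _)]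
        exact (euclNorm_le_sum x).trans (hlin _ x)
    have i2 : Integrable w (gpi (Fin d)) :=
      gpi_dom 1 1 _ hwc.aestronglyMeasurable fun x => (hwb x).trans (hlin _ x)
    have j1 := m1.integrable_comp_of_integrable i1
    have j2 := m2.integrable_comp_of_integrable i2
    have e1 : ∫ z : Fin n ⊕ Fin d → ℝ, euclNorm (fun j => z (Sum.inl j)) ∂(gpi (Fin n ⊕ Fin d)) =
        ∫ g, euclNorm g ∂(stdGaussian n) := by
      change _ = ∫ g, euclNorm g ∂(gpi (Fin n))
      rw [← m1.map_eq, integral_map m1.measurable.aemeasurable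
        cont_euclNorm.aestronglyMeasurable]
    have e2 : ∫ z : Fin n ⊕ Fin d → ℝ, w (fun j => z (Sum.inr j)) ∂(gpi (Fin n ⊕ Fin d)) =
        ∫ h, w h ∂(stdGaussian d) := by
      change _ = ∫ g, w g ∂(gpi (Fin d))
      rw [← m2.map_eq, integral_map m2.measurable.aemeasurable
        hwc.aestronglyMeasurable]
    unfold ZZ
    have := integral_sub j1 j2
    simp only [Function.comp_def] at this
    rw [this, e1, e2, hc]
    ring
  have : Nonempty T := hne.to_subtype
  set s : ℕ → T := TopologicalSpace.denseSeq T
  have hs : DenseRange s := TopologicalSpace.denseRange_denseSeq T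
  set A : ℕ → Set (Fin n × Fin d → ℝ) := fun m =>
    {X | ∃ i : Fin (m + 1), euclNorm (fun j => ∑ l, (s i : Fin d → ℝ) l * X (j, l)) < c} with hA
  have hAm : Monotone A := by
    rintro m m' h X ⟨i, hi⟩
    exact ⟨⟨i, by omega⟩, hi⟩
  have hsub : {X : Fin n × Fin d → ℝ | ∃ t ∈ T, euclNorm (fun j => ∑ l, t l * X (j, l)) < c} ⊆
      ⋃ m, A m := by
    rintro X ⟨t, ht, hX⟩
    have ho : IsOpen {t : T | euclNorm (fun j => ∑ l, (t : Fin d → ℝ) l * X (j, l)) < c} :=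
      isOpen_lt (cont_euclNorm.comp (continuous_pi fun j => continuous_finsetSum _ fun l _ =>
        ((continuous_apply l).comp continuous_subtype_val).mul continuous_const)) continuous_const
    obtain ⟨i, hi⟩ := hs.exists_mem_open ho ⟨⟨t, ht⟩, hX⟩
    exact Set.mem_iUnion.2 ⟨i, ⟨i, by omega⟩, hi⟩
  refine (measure_mono hsub).trans ?_
  rw [hAm.measure_iUnion]
  refine iSup_le fun m => ?_
  have hTs : ∀ i : Fin (m + 1), ∑ l, (s i : Fin d → ℝ) l * (s i : Fin d → ℝ) l = 1 := fun i => by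
    have h1 := hT _ (s i).2
    have h2 := Real.sq_sqrt (Finset.sum_nonneg fun (l : Fin d) (_ : l ∈ Finset.univ) =>
      sq_nonneg ((s i : Fin d → ℝ) l))
    unfold euclNorm at h1
    rw [h1] at h2
    simp_rw [← pow_two]
    linarith
  have key := fin_escape (n := n) (fun i : Fin (m + 1) => (s i : Fin d → ℝ)) hTs w hwc hwb
    (fun i h => hw _ (s i).2 h) (c := c) hθ
  rw [hEZ] at key
  have e : θ * c + θ ^ 2 / 2 - θ * (c + θ) = -θ ^ 2 / 2 := by ring
  rw [e] at key
  rw [← ENNReal.ofReal_toReal (measure_ne_top (gpi (Fin n × Fin d)) (A m))]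
  exact ENNReal.ofReal_le_ofReal key

end final

/-- Generalized escape-through-a-mesh (lower bound): for a matrix `H` with i.i.d. standard
Gaussian entries (`H = √n G`), `B` with smallest singular value `σ_b > 0`, a cone `C`, Gaussian
width `W = W(BC ∩ S^{d-1})` and `p_n = E‖g‖`, with probability at least `1 - exp(-θ²/2)`:
`‖H B v‖ ≥ (p_n - W - θ)‖Bv‖ ≥ σ_b (p_n - W - θ)‖v‖` for all `v ∈ C`. -/
theorem escape_through_mesh_lower {n d : ℕ} (B : Matrix (Fin d) (Fin d) ℝ)
    (C : Set (Fin d → ℝ)) (hcone : ∀ a : ℝ, 0 ≤ a → ∀ v ∈ C, a • v ∈ C)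
    (σb : ℝ) (hσb : 0 < σb)
    (hσ : ∀ v : Fin d → ℝ, σb * euclNorm v ≤ euclNorm (B.mulVec v))
    (θ : ℝ) (hθ : 0 ≤ θ)
    (pn : ℝ) (hpn : pn = ∫ g, euclNorm g ∂(stdGaussian n))
    (T : Set (Fin d → ℝ))
    (hT : T = {u | (∃ v ∈ C, u = B.mulVec v) ∧ euclNorm u = 1})
    (W : ℝ) (hW : W = ∫ h, sSup {r : ℝ | ∃ t ∈ T, r = dot t h} ∂(stdGaussian d)) :
    1 - Real.exp (-θ ^ 2 / 2) ≤
      ((stdGaussianMatrix n d)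
        {H | ∀ v ∈ C,
          (pn - W - θ) * euclNorm (B.mulVec v) ≤ euclNorm ((Matrix.of H * B).mulVec v) ∧
          σb * (pn - W - θ) * euclNorm v ≤ euclNorm ((Matrix.of H * B).mulVec v)}).toReal := by
  rcases hθ.eq_or_lt with h0 | hθ0
  · rw [← h0]; simp
  set c := pn - W - θ with hc
  have hTu : ∀ t ∈ T, euclNorm t = 1 := by
    intro t ht
    rw [hT] at ht
    exact ht.2
  have hesc := set_escape (n := n) T hTu hθ0 (c := c) (by rw [hc, hpn, hW])
  have hmp : MeasurePreserving (fun (x : Fin n × Fin d → ℝ) i j => x (i, j))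
      (gpi (Fin n × Fin d)) (stdGaussianMatrix n d) := gpi_curry (Fin n) (Fin d)
  set G : Set (Fin n → Fin d → ℝ) := {H | ∀ t ∈ T, c ≤ euclNorm (fun j => ∑ l, t l * H j l)} with hG
  have hGc : IsClosed G := by
    have : G = ⋂ t ∈ T, {H | c ≤ euclNorm (fun j => ∑ l, t l * H j l)} := by
      ext H; simp [hG]
    rw [this]
    refine isClosed_biInter fun t _ => isClosed_le continuous_const
      (cont_euclNorm.comp (by fun_prop))
  set A : Set (Fin n × Fin d → ℝ) :=
    {X | ∃ t ∈ T, euclNorm (fun j => ∑ l, t l * X (j, l)) < c} with hA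
  have hpre : (fun (x : Fin n × Fin d → ℝ) i j => x (i, j)) ⁻¹' G = Aᶜ := by
    ext X; simp [hG, hA]
  have hAm : MeasurableSet A := by
    rw [← compl_compl A, ← hpre]
    exact (hmp.measurable hGc.measurableSet).compl
  have hPG : (stdGaussianMatrix n d) G = 1 - gpi (Fin n × Fin d) A := by
    rw [← hmp.measure_preimage hGc.measurableSet.nullMeasurableSet, hpre, prob_compl_eq_one_sub hAm]
  have : IsProbabilityMeasure (stdGaussianMatrix n d) := by
    unfold stdGaussianMatrix _root_.stdGaussian; infer_instance
  have hlow : 1 - Real.exp (-θ ^ 2 / 2) ≤ ((stdGaussianMatrix n d) G).toReal := by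
    rw [hPG, ENNReal.toReal_sub_of_le prob_le_one ENNReal.one_ne_top, ENNReal.toReal_one]
    have := ENNReal.toReal_mono ENNReal.ofReal_ne_top hesc
    rw [ENNReal.toReal_ofReal (Real.exp_pos _).le] at this
    linarith
  refine hlow.trans (ENNReal.toReal_mono (measure_ne_top _ _) (measure_mono ?_))
  intro H hH v hv
  rw [← Matrix.mulVec_mulVec]
  set u := B.mulVec v with hu
  have hscale : ∀ (m : ℕ) (a : ℝ) (y : Fin m → ℝ), 0 ≤ a →
      euclNorm (fun j => a * y j) = a * euclNorm y := by
    intro m a y ha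
    unfold euclNorm
    simp_rw [mul_pow]
    rw [← Finset.mul_sum, Real.sqrt_mul (sq_nonneg a), Real.sqrt_sq ha]
  have hfirst : c * euclNorm u ≤ euclNorm ((Matrix.of H).mulVec u) := by
    rcases (euclNorm_nonneg u).eq_or_lt with hr | hr
    · rw [← hr, mul_zero]; exact euclNorm_nonneg _
    set r := euclNorm u with hrd
    have hmem : (fun j => r⁻¹ * u j) ∈ T := by
      rw [hT]
      refine ⟨⟨r⁻¹ • v, hcone _ (inv_nonneg.2 hr.le) v hv, ?_⟩, ?_⟩
      · rw [Matrix.mulVec_smul]; rfl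
      · rw [hscale _ _ _ (inv_nonneg.2 hr.le)]
        exact inv_mul_cancel₀ hr.ne'
    have h1 := hH _ hmem
    have e : (fun j => ∑ l, r⁻¹ * u l * H j l) = fun j => r⁻¹ * (Matrix.of H).mulVec u j := by
      funext j
      simp only [Matrix.mulVec, dotProduct, Matrix.of_apply]
      rw [Finset.mul_sum]
      exact Finset.sum_congr rfl fun l _ => by ring
    rw [e, hscale _ _ _ (inv_nonneg.2 hr.le), le_inv_mul_iff₀ hr] at h1
    linarith
  refine ⟨hfirst, ?_⟩
  rcases le_total 0 c with h | h
  · have := mul_le_mul_of_nonneg_left (hσ v) h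
    calc _ = c * (σb * euclNorm v) := by ring
      _ ≤ _ := this
      _ ≤ _ := hfirst
  · have h1 : σb * c * euclNorm v ≤ 0 :=
      mul_nonpos_of_nonpos_of_nonneg (mul_nonpos_of_nonneg_of_nonpos hσb.le h) (euclNorm_nonneg _)
    exact h1.trans (euclNorm_nonneg _)
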